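/- arXiv:2601.04384 — 2 statements merged into one kernel-verified Lean document; each statement's English description precedes it below -/
import Mathlib

section
/- Let w, v ∈ ℝ^n with Δ(v) := min_{i≠j} |v_i − v_j| > 0. Let w̄ = n^{−1} ∑_i w_i and σ² = ∑_i (w_i − w̄)². Then there is an absolute constant C such that for every closed interval I, with π a uniformly random permutation of {1,...,n}, P(∑_i w_{π(i)} v_i ∈ I) ≤ C (|I| √(log n) / (n σ Δ(v)) + 1/n). -/
open scoped Classical
open Finset

noncomputable def kap (y : ℝ) : ℝ := ∫ t in (0:ℝ)..1, (1 - t) * Real.cos (t * y)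

lemma kap_eq (y : ℝ) (hy : y ≠ 0) : kap y = (1 - Real.cos y) / y ^ 2 := by
  unfold kap
  have h : ∀ t ∈ Set.uIcc (0:ℝ) 1, HasDerivAt (fun t : ℝ => (1 - t) * (Real.sin (t * y) / y) - Real.cos (t * y) / y ^ 2)
      ((1 - t) * Real.cos (t * y)) t := by
    intro t _
    have h1 : HasDerivAt (fun t : ℝ => t * y) y t := by simpa using (hasDerivAt_id t).mul_const y
    have h2 := (h1.sin).div_const y
    have h3 := (h1.cos).div_const (y ^ 2)
    have h4 : HasDerivAt (fun t : ℝ => 1 - t) (-1) t := by simpa using (hasDerivAt_id t).const_sub 1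
    refine ((h4.mul h2).sub h3).congr_deriv ?_
    have : y * y⁻¹ = 1 := mul_inv_cancel₀ hy
    simp only [div_eq_mul_inv]
    linear_combination ((1 - t) * Real.cos (t * y) + Real.sin (t * y) * y⁻¹) * this
  rw [intervalIntegral.integral_eq_sub_of_hasDerivAt h]
  · simp; ring
  · apply Continuous.intervalIntegrable; fun_prop

lemma kap_nonneg (y : ℝ) : 0 ≤ kap y := by
  by_cases hy : y = 0
  · subst hy
    unfold kap
    apply intervalIntegral.integral_nonneg (by norm_num)
    intro t ht
    simp only [mul_zero, Real.cos_zero, mul_one]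
    linarith [ht.2]
  · rw [kap_eq y hy]
    have := Real.cos_le_one y
    apply div_nonneg (by linarith) (by positivity)

lemma kap_zero : kap 0 = 1 / 2 := by
  unfold kap
  simp only [mul_zero, Real.cos_zero, mul_one]
  rw [intervalIntegral.integral_sub (by simp) (by simp), integral_id]
  norm_num

lemma kap_lower (y : ℝ) (hy : |y| ≤ 1) : 1 ≤ 5 * kap y := by
  by_cases h0 : y = 0
  · subst h0; rw [kap_zero]; norm_num
  · rw [kap_eq y h0]
    have h := Real.cos_le_one_sub_mul_cos_sq (x := y) (by linarith [Real.pi_gt_three])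
    have hpi : Real.pi ^ 2 ≤ 10 := by
      have := Real.pi_lt_d2
      nlinarith [Real.pi_pos]
    have hy2 : 0 < y ^ 2 := by positivity
    have h2 : (1:ℝ)/5 ≤ 2 / Real.pi ^ 2 := by
      rw [div_le_div_iff₀ (by norm_num) (by positivity)]; linarith
    have : 1 / 5 * y ^ 2 ≤ 1 - Real.cos y := by nlinarith
    rw [← mul_div_assoc, le_div_iff₀ hy2]
    linarith

lemma kap_upper (y : ℝ) (m : ℝ) (hm : m = 0 ∨ 1 ≤ m) (hy : 2 * m ≤ |y|) : kap y ≤ 2 / (1 + m) ^ 2 := by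
  have hm0 : 0 ≤ m := by rcases hm with h | h <;> linarith
  by_cases h0 : y = 0
  · subst h0
    have : m = 0 := by simp at hy; linarith
    subst this; rw [kap_zero]; norm_num
  · rcases hm with h | h
    · subst h
      rw [kap_eq y h0, div_le_iff₀ (by positivity)]
      have := Real.one_sub_sq_div_two_le_cos (x := y)
      nlinarith [sq_nonneg y]
    · rw [kap_eq y h0, div_le_div_iff₀ (by positivity) (by positivity)]
      have h1 := Real.neg_one_le_cos y
      have h2 : (2 * m) ^ 2 ≤ y ^ 2 := by rw [← sq_abs y]; gcongr
      have h3 : (1 + m) ^ 2 ≤ y ^ 2 := by nlinarith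
      nlinarith [sq_nonneg (1 + m)]

/-- cosine product lemma -/
lemma cosprod {G ι : Type*} [Fintype G] [Group G] (s : ι → G) (x : ι → G → ℝ)
    (hx2 : ∀ i j π, i ≠ j → x i (π * s j) = x i π)
    (S : Finset ι) : ∀ (Y H : G → ℝ), (∀ i ∈ S, ∀ π, Y (π * s i) = Y π - 2 * x i π) →
      (∀ i ∈ S, ∀ π, H (π * s i) = H π) →
      ∑ π, Real.cos (Y π) * H π ≤ ∑ π, (∏ i ∈ S, |Real.cos (x i π)|) * |H π| := by
  induction S using Finset.induction_on with
  | empty =>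
    intro Y H _ _
    apply Finset.sum_le_sum
    intro π _
    simp only [prod_empty, one_mul]
    calc _ ≤ |Real.cos (Y π) * H π| := le_abs_self _
      _ = |Real.cos (Y π)| * |H π| := abs_mul _ _
      _ ≤ 1 * |H π| := by gcongr; exact Real.abs_cos_le_one _
      _ = _ := one_mul _
  | insert j S hj ih =>
    intro Y H hY hH
    have key : ∑ π, Real.cos (Y π) * H π
        = ∑ π, Real.cos (Y π - x j π) * (H π * Real.cos (x j π)) := by
      have e1 : ∑ π, Real.cos (Y π) * H π = ∑ π, Real.cos (Y (π * s j)) * H (π * s j) :=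
        (Equiv.sum_comp (Equiv.mulRight (s j)) (fun π => Real.cos (Y π) * H π)).symm
      have e2 : ∑ π, Real.cos (Y π) * H π = ∑ π, (Real.cos (Y π) * H π + Real.cos (Y (π * s j)) * H (π * s j)) / 2 := by
        rw [← Finset.sum_div, Finset.sum_add_distrib, ← e1]; ring
      rw [e2]
      apply Finset.sum_congr rfl
      intro π _
      rw [hY j (mem_insert_self _ _), hH j (mem_insert_self _ _)]
      generalize hz : Y π - x j π = z at *
      have c1 : Real.cos (Y π) = Real.cos (z + x j π) := by congr 1; rw [← hz]; ring
      have c2 : Real.cos (Y π - 2 * x j π) = Real.cos (z - x j π) := by congr 1; rw [← hz]; ring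
      rw [c2, c1, Real.cos_add, Real.cos_sub]
      ring
    rw [key]
    refine (ih _ _ ?_ ?_).trans (le_of_eq ?_)
    · intro i hi π
      have hij : j ≠ i := fun h => hj (h ▸ hi)
      rw [hY i (mem_insert_of_mem hi), hx2 j i π hij]; ring
    · intro i hi π
      have hij : j ≠ i := fun h => hj (h ▸ hi)
      rw [hH i (mem_insert_of_mem hi), hx2 j i π hij]
    · apply Finset.sum_congr rfl
      intro π _
      rw [Finset.prod_insert hj, abs_mul]; ring

/-- permutations with prescribed values -/
lemma fiber_card {n : ℕ} {κ : Type} [Fintype κ] (e : κ → Fin n) (he : Function.Injective e) (f : κ → Fin n) :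
    (univ.filter (fun π : Equiv.Perm (Fin n) => ∀ i, π (e i) = f i)).card ≤ (n - Fintype.card κ).factorial := by
  by_cases h : ∃ π0 : Equiv.Perm (Fin n), ∀ i, π0 (e i) = f i
  · obtain ⟨π0, h0⟩ := h
    have hc : Fintype.card {ρ : Equiv.Perm (Fin n) // ∀ a, ¬ (a ∉ Set.range e) → ρ a = a} = (n - Fintype.card κ).factorial := by
      rw [← Fintype.card_congr (Equiv.Perm.subtypeEquivSubtypePerm (fun a => a ∉ Set.range e)), Fintype.card_perm]
      congr 1
      rw [Fintype.card_subtype_compl]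
      have := Set.card_range_of_injective he
      simp only [Fintype.card_fin] at this ⊢
      congr 1
    rw [← hc, ← Fintype.card_coe]
    refine Fintype.card_le_of_injective (fun π => ⟨π0⁻¹ * π.1, ?_⟩) ?_
    · intro a ha
      push Not at ha
      obtain ⟨i, rfl⟩ := ha
      have := (Finset.mem_filter.1 π.2).2 i
      simp only [Equiv.Perm.mul_apply, this, ← h0 i, Equiv.Perm.inv_def, Equiv.symm_apply_apply]
    · intro π π' h
      simp only [Subtype.mk.injEq, mul_right_inj] at h
      exact Subtype.ext h
  · rw [Finset.filter_false_of_mem]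
    · simp
    · intro π _ hp
      exact h ⟨π, hp⟩

lemma prod_indep {n k : ℕ} (a b : Fin k → Fin n) (hab : Function.Injective (Sum.elim a b))
    (G : Fin k → Fin n → Fin n → ℝ) (hG : ∀ i p q, 0 ≤ G i p q) :
    ∑ π : Equiv.Perm (Fin n), ∏ i, G i (π (a i)) (π (b i))
      ≤ ((n - 2 * k).factorial : ℝ) * ∏ i, ∑ p, ∑ q, G i p q := by
  have h1 : ∏ i, ∑ p, ∑ q, G i p q = ∑ τ : Fin k → Fin n × Fin n, ∏ i, G i (τ i).1 (τ i).2 := by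
    have : ∀ i, ∑ p, ∑ q, G i p q = ∑ x : Fin n × Fin n, G i x.1 x.2 := by
      intro i; rw [Fintype.sum_prod_type]
    simp_rw [this]
    rw [Finset.prod_univ_sum]
    simp
  rw [h1, ← Finset.sum_fiberwise (s := univ) (g := fun π : Equiv.Perm (Fin n) => fun i => (π (a i), π (b i))), Finset.mul_sum]
  apply Finset.sum_le_sum
  intro τ _
  have h2 : ∀ π ∈ univ.filter (fun π : Equiv.Perm (Fin n) => (fun i => (π (a i), π (b i))) = τ),
      ∏ i, G i (π (a i)) (π (b i)) = ∏ i, G i (τ i).1 (τ i).2 := by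
    intro π hπ
    have := (Finset.mem_filter.1 hπ).2
    subst this
    rfl
  rw [Finset.sum_congr rfl h2, Finset.sum_const, nsmul_eq_mul]
  apply mul_le_mul_of_nonneg_right _ (Finset.prod_nonneg fun i _ => hG _ _ _)
  have h3 := fiber_card (Sum.elim a b) hab (Sum.elim (fun i => (τ i).1) (fun i => (τ i).2))
  simp only [Fintype.card_sum, Fintype.card_fin, ← two_mul] at h3
  refine Nat.cast_le.2 (le_trans (Finset.card_le_card ?_) h3)
  intro π hπ
  have := (Finset.mem_filter.1 hπ).2
  subst this
  simp

lemma fact_ratio {n k : ℕ} (h : 200 * k ≤ n) :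
    ((n - 2 * k).factorial : ℝ) * (n:ℝ) ^ (2 * k) ≤ n.factorial * Real.exp (k / 32) := by
  have h1 : (n - 2 * k).factorial * n.descFactorial (2 * k) = n.factorial :=
    Nat.factorial_mul_descFactorial (by omega)
  have h2 := Nat.pow_sub_le_descFactorial n (2 * k)
  have h3 : ((n:ℝ) * (99/100)) ^ (2 * k) ≤ (n.descFactorial (2 * k) : ℝ) := by
    refine le_trans ?_ (by exact_mod_cast h2 : (((n + 1 - 2 * k : ℕ) : ℝ)) ^ (2 * k) ≤ _)
    gcongr
    rw [Nat.cast_sub (by omega)]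
    push_cast
    have : (200:ℝ) * k ≤ n := by exact_mod_cast h
    linarith
  have h4 : ((100/99:ℝ)) ^ (2 * k) ≤ Real.exp (k / 32) := by
    rw [pow_mul]
    have : ((k:ℝ)/32) = k * (1/32) := by ring
    rw [this, Real.exp_nat_mul]
    gcongr
    have := Real.add_one_le_exp (1/32 : ℝ)
    norm_num at this ⊢
    linarith
  have h5 : (n:ℝ) ^ (2 * k) = ((n:ℝ) * (99/100)) ^ (2 * k) * (100/99:ℝ) ^ (2 * k) := by
    rw [← mul_pow]; congr 1; ring
  rw [h5, ← h1]
  push_cast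
  rw [mul_assoc ((n - 2 * k).factorial : ℝ)]
  gcongr

noncomputable def Ff {n : ℕ} (v : Fin n → ℝ) (z : ℝ) (s : ℝ) : ℝ :=
  (∑ p, ∑ q, Real.cos (s * (z * (v p - v q)))) / (n:ℝ) ^ 2

lemma Ff_nonneg {n : ℕ} (v : Fin n → ℝ) (z : ℝ) (s : ℝ) : 0 ≤ Ff v z s := by
  unfold Ff
  apply div_nonneg _ (by positivity)
  have : ∑ p, ∑ q, Real.cos (s * (z * (v p - v q)))
      = (∑ p, Real.cos (s * z * v p)) ^ 2 + (∑ p, Real.sin (s * z * v p)) ^ 2 := by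
    rw [sq, sq, Finset.sum_mul_sum, Finset.sum_mul_sum, ← Finset.sum_add_distrib]
    apply Finset.sum_congr rfl; intro p _
    rw [← Finset.sum_add_distrib]
    apply Finset.sum_congr rfl; intro q _
    rw [← Real.cos_sub]; congr 1; ring
  rw [this]; positivity

lemma exp_aux (x : ℝ) (h0 : 0 ≤ x) (h1 : x ≤ 1 / 2) : Real.exp (-x) ≤ 1 - 3 / 4 * x := by
  have hc := convexOn_exp.2 (Set.mem_univ (0:ℝ)) (Set.mem_univ (-1/2:ℝ))
    (show 0 ≤ 1 - 2 * x by linarith) (show 0 ≤ 2 * x by linarith) (by ring)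
  simp only [smul_eq_mul, mul_zero, zero_add, Real.exp_zero, mul_one] at hc
  have e : 2 * x * (-1/2) = -x := by ring
  rw [e] at hc
  have h2 : Real.exp (-1/2) ≤ 5/8 := by
    have h3 := Real.quadratic_le_exp_of_nonneg (x := 1/2) (by norm_num)
    have : Real.exp (-1/2) = (Real.exp (1/2))⁻¹ := by rw [← Real.exp_neg]; norm_num
    rw [this]
    apply inv_le_of_inv_le₀ (by norm_num)
    norm_num at h3 ⊢
    linarith
  nlinarith

lemma psi_bound {n k : ℕ} (hn : 1 ≤ n) (h : 200 * k ≤ n) (a b : Fin k → Fin n)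
    (hab : Function.Injective (Sum.elim a b)) (v : Fin n → ℝ) (z : Fin k → ℝ) (s : ℝ) :
    ∑ π : Equiv.Perm (Fin n), Real.exp (- ∑ i, (1 - Real.cos (s * (z i * (v (π (a i)) - v (π (b i)))))) / 4)
     ≤ n.factorial * Real.exp (k / 32 - 3 / 16 * ∑ i, (1 - Ff v (z i) s)) := by
  have hn' : (0:ℝ) < n := by exact_mod_cast hn
  have e1 := prod_indep a b hab (fun i p q => Real.exp (-((1 - Real.cos (s * (z i * (v p - v q)))) / 4)))
    (fun i p q => (Real.exp_pos _).le)
  simp only [← Real.exp_sum, Finset.sum_neg_distrib] at e1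
  refine e1.trans ?_
  have e2 : ∀ i, ∑ p, ∑ q, Real.exp (-((1 - Real.cos (s * (z i * (v p - v q)))) / 4))
      ≤ (n:ℝ) ^ 2 * Real.exp (- (3 / 16 * (1 - Ff v (z i) s))) := by
    intro i
    calc _ ≤ ∑ p : Fin n, ∑ q : Fin n, (13/16 + 3 / 16 * Real.cos (s * (z i * (v p - v q)))) := by
          apply Finset.sum_le_sum; intro p _
          apply Finset.sum_le_sum; intro q _
          have c1 := Real.cos_le_one (s * (z i * (v p - v q)))
          have c2 := Real.neg_one_le_cos (s * (z i * (v p - v q)))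
          refine (exp_aux _ (by linarith) (by linarith)).trans ?_
          linarith
      _ = (n:ℝ) ^ 2 * (1 - (3 / 16 * (1 - Ff v (z i) s))) := by
          simp only [Finset.sum_add_distrib, ← Finset.mul_sum, Finset.sum_const, Finset.card_univ, Fintype.card_fin, nsmul_eq_mul]
          unfold Ff
          field_simp
          ring
      _ ≤ _ := by
          gcongr
          have := Real.add_one_le_exp (- (3 / 16 * (1 - Ff v (z i) s)))
          linarith
  calc _ ≤ ((n - 2 * k).factorial : ℝ) * ∏ i : Fin k, ((n:ℝ) ^ 2 * Real.exp (- (3 / 16 * (1 - Ff v (z i) s)))) := by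
        gcongr with i _
        exact e2 i
    _ = ((n - 2 * k).factorial : ℝ) * (n:ℝ) ^ (2 * k) * Real.exp (-(3 / 16 * ∑ i, (1 - Ff v (z i) s))) := by
        rw [Finset.prod_mul_distrib, ← Real.exp_sum, Finset.sum_neg_distrib, ← Finset.mul_sum]
        simp [pow_mul, mul_assoc]
    _ ≤ n.factorial * Real.exp (k / 32) * Real.exp (-(3 / 16 * ∑ i, (1 - Ff v (z i) s))) := by
        exact mul_le_mul_of_nonneg_right (fact_ratio h) (Real.exp_pos _).le
    _ = _ := by rw [mul_assoc, ← Real.exp_add]; congr 2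

lemma ind_bound {n k l : ℕ} (hk : k = 32 * 4 ^ l) (hn : 1 ≤ n) (h : 200 * k ≤ n) (a b : Fin k → Fin n)
    (hab : Function.Injective (Sum.elim a b)) (v : Fin n → ℝ) (z : Fin k → ℝ) (s : ℝ) :
    ∑ π : Equiv.Perm (Fin n), (if ∑ i, (1 - Real.cos (s * (z i * (v (π (a i)) - v (π (b i)))))) / 4 ≤ (4:ℝ) ^ l then (1:ℝ) else 0)
     ≤ n.factorial * (2 * ((∑ i, Ff v (z i) s) / k) + Real.exp (-(4:ℝ) ^ l)) := by
  have hk0 : (0:ℝ) < k := by rw [hk]; positivity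
  have hkr : (k:ℝ) = 32 * 4 ^ l := by rw [hk]; push_cast; ring
  have hF : 0 ≤ (∑ i, Ff v (z i) s) / k := div_nonneg (Finset.sum_nonneg fun i _ => Ff_nonneg _ _ _) hk0.le
  by_cases hc : (∑ i, Ff v (z i) s) / k ≤ 1 / 2
  · have hb := psi_bound hn h a b hab v z s
    calc _ ≤ ∑ π : Equiv.Perm (Fin n), Real.exp ((4:ℝ)^l) * Real.exp (- ∑ i, (1 - Real.cos (s * (z i * (v (π (a i)) - v (π (b i)))))) / 4) := by
          apply Finset.sum_le_sum; intro π _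
          rw [← Real.exp_add]
          split_ifs with hh
          · apply Real.one_le_exp; linarith
          · positivity
      _ ≤ Real.exp ((4:ℝ)^l) * (n.factorial * Real.exp (k / 32 - 3 / 16 * ∑ i, (1 - Ff v (z i) s))) := by
          rw [← Finset.mul_sum]; gcongr
      _ = n.factorial * Real.exp ((4:ℝ)^l + (k / 32 - 3 / 16 * ∑ i, (1 - Ff v (z i) s))) := by
          rw [Real.exp_add]; ring
      _ ≤ n.factorial * Real.exp (-(4:ℝ)^l) := by
          gcongr
          rw [div_le_iff₀ hk0] at hc
          rw [Finset.sum_sub_distrib]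
          simp only [Finset.sum_const, Finset.card_univ, Fintype.card_fin, nsmul_eq_mul, mul_one]
          linarith
      _ ≤ _ := by gcongr; linarith
  · push Not at hc
    calc _ ≤ ∑ π : Equiv.Perm (Fin n), (1:ℝ) := by
          apply Finset.sum_le_sum; intro π _; split_ifs <;> norm_num
      _ = n.factorial * 1 := by simp [Fintype.card_perm]
      _ ≤ _ := by
        gcongr
        have := Real.exp_pos (-(4:ℝ)^l)
        linarith

lemma sum_inv_sq (N : ℕ) : ∑ m ∈ range N, 1 / (1 + (m:ℝ)) ^ 2 ≤ 2 := by
  have : ∀ N : ℕ, ∑ m ∈ range (N + 1), 1 / (1 + (m:ℝ)) ^ 2 ≤ 2 - 1 / ((N:ℝ) + 1) := by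
    intro N
    induction N with
    | zero => norm_num
    | succ N ih =>
      rw [Finset.sum_range_succ]
      have : 1 / (1 + ((N+1 : ℕ):ℝ)) ^ 2 ≤ 1 / ((N:ℝ) + 1) - 1 / (((N + 1 : ℕ):ℝ) + 1) := by
        push_cast
        rw [div_sub_div _ _ (by positivity) (by positivity), div_le_div_iff₀ (by positivity) (by positivity)]
        ring_nf
        nlinarith [(Nat.cast_nonneg N : (0:ℝ) ≤ N)]
      linarith
  rcases N with _ | N
  · simp
  · have h := this N
    have : 0 ≤ 1 / ((N:ℝ) + 1) := by positivity
    linarith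

lemma sum_sep {n : ℕ} (p : Fin n) : ∑ q : Fin n, 2 / (1 + |(p:ℝ) - (q:ℝ)|) ^ 2 ≤ 8 := by
  obtain ⟨p, hp⟩ := p
  rw [Fin.sum_univ_eq_sum_range (fun q => 2 / (1 + |(p:ℝ) - (q:ℝ)|) ^ 2) n]
  rw [← Finset.sum_range_add_sum_Ico _ (show p + 1 ≤ n from hp)]
  have h1 : ∑ q ∈ range (p + 1), 2 / (1 + |(p:ℝ) - (q:ℝ)|) ^ 2 ≤ 4 := by
    rw [← Finset.sum_range_reflect]
    have := sum_inv_sq (p + 1)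
    calc _ = 2 * ∑ m ∈ range (p + 1), 1 / (1 + (m:ℝ)) ^ 2 := by
          rw [Finset.mul_sum]
          apply Finset.sum_congr rfl
          intro m hm
          have hm' : m ≤ p := by simpa [Nat.lt_succ_iff] using hm
          rw [show p + 1 - 1 - m = p - m by omega, Nat.cast_sub hm']
          rw [show (p:ℝ) - (p - m) = m by ring, abs_of_nonneg (by positivity)]
          ring
      _ ≤ _ := by linarith
  have h2 : ∑ q ∈ Ico (p + 1) n, 2 / (1 + |(p:ℝ) - (q:ℝ)|) ^ 2 ≤ 4 := by
    rw [Finset.sum_Ico_eq_sum_range]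
    have := sum_inv_sq (n - (p + 1))
    calc _ ≤ 2 * ∑ m ∈ range (n - (p + 1)), 1 / (1 + (m:ℝ)) ^ 2 := by
          rw [Finset.mul_sum]
          apply Finset.sum_le_sum
          intro m hm
          push_cast
          rw [show (p:ℝ) - (p + 1 + m) = -(1 + m) by ring, abs_neg, abs_of_nonneg (by positivity), mul_one_div]
          gcongr
          linarith
      _ ≤ _ := by linarith
  linarith

lemma Ff_cont {n : ℕ} (v : Fin n → ℝ) (z : ℝ) : Continuous (Ff v z) := by
  unfold Ff; fun_prop

lemma Ff_int {n : ℕ} (hn : 1 ≤ n) (v : Fin n → ℝ) (z : ℝ)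
    (hv : ∀ p q : Fin n, |(p:ℝ) - (q:ℝ)| ≤ |z * (v p - v q)|) :
    ∫ s in (0:ℝ)..1, Ff v z s ≤ 32 / n := by
  have hn' : (0:ℝ) < n := by exact_mod_cast hn
  have hc := Ff_cont v z
  have e1 : ∫ s in (0:ℝ)..1, Ff v z s = 2 * ∫ u in (0:ℝ)..(1/2), Ff v z (2 * u) := by
    rw [intervalIntegral.integral_comp_mul_left _ (by norm_num : (2:ℝ) ≠ 0)]
    norm_num
    ring
  have e2 : ∫ u in (0:ℝ)..(1/2), Ff v z (2 * u) ≤ ∫ u in (0:ℝ)..(1/2), 2 * ((1 - u) * Ff v z (2 * u)) := by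
    apply intervalIntegral.integral_mono_on (by norm_num)
    · apply Continuous.intervalIntegrable; fun_prop
    · apply Continuous.intervalIntegrable; fun_prop
    · intro u hu
      have := Ff_nonneg v z (2 * u)
      nlinarith [hu.2]
  have e3 : ∫ u in (0:ℝ)..(1/2), 2 * ((1 - u) * Ff v z (2 * u)) ≤ ∫ u in (0:ℝ)..1, 2 * ((1 - u) * Ff v z (2 * u)) := by
    rw [← intervalIntegral.integral_add_adjacent_intervals (a := (0:ℝ)) (b := 1/2) (c := 1)]
    · have : 0 ≤ ∫ u in (1/2:ℝ)..1, 2 * ((1 - u) * Ff v z (2 * u)) := by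
        apply intervalIntegral.integral_nonneg (by norm_num)
        intro u hu
        have := Ff_nonneg v z (2 * u)
        have h2 : 0 ≤ 1 - u := by linarith [hu.2]
        positivity
      linarith
    · apply Continuous.intervalIntegrable; fun_prop
    · apply Continuous.intervalIntegrable; fun_prop
  have e4 : ∫ u in (0:ℝ)..1, 2 * ((1 - u) * Ff v z (2 * u)) = 2 * ((∑ p, ∑ q, kap (2 * (z * (v p - v q)))) / (n:ℝ)^2) := by
    rw [intervalIntegral.integral_const_mul]
    congr 1
    unfold kap
    have : ∀ u : ℝ, (1 - u) * Ff v z (2 * u) = (∑ p, ∑ q, (1 - u) * Real.cos (u * (2 * (z * (v p - v q))))) / (n:ℝ)^2 := by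
      intro u
      unfold Ff
      simp only [← Finset.mul_sum]
      rw [mul_div_assoc]
      congr 4
      ext p; congr 1; ext q; congr 1; ring
    simp_rw [this]
    rw [intervalIntegral.integral_div]
    congr 1
    rw [intervalIntegral.integral_finsetSum]
    · apply Finset.sum_congr rfl; intro p _
      rw [intervalIntegral.integral_finsetSum]
      intro q _
      apply Continuous.intervalIntegrable; fun_prop
    · intro q _
      apply Continuous.intervalIntegrable; fun_prop
  have e5 : ∑ p, ∑ q, kap (2 * (z * (v p - v q))) ≤ n * 8 := by
    calc _ ≤ ∑ p : Fin n, (8:ℝ) := by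
          apply Finset.sum_le_sum; intro p _
          refine le_trans (Finset.sum_le_sum ?_) (sum_sep p)
          intro q _
          apply kap_upper
          · by_cases h : p = q
            · left; simp [h]
            · right
              have : (p:ℤ) - (q:ℤ) ≠ 0 := by
                intro h'; apply h; ext; omega
              have := Int.one_le_abs this
              exact_mod_cast this
          · rw [abs_mul 2, abs_two]
            linarith [hv p q]
      _ = _ := by simp
  rw [e1]
  have e6 : (∑ p, ∑ q, kap (2 * (z * (v p - v q)))) / (n:ℝ)^2 ≤ 8 / n := by
    rw [div_le_div_iff₀ (by positivity) hn']
    nlinarith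
  have : (32:ℝ) / n = 4 * (8 / n) := by ring
  rw [this]
  linarith

lemma dyadic (ψ : ℝ → ℝ) (h2 : ∀ t, ψ (2 * t) ≤ 4 * ψ t) (l : ℕ) (t : ℝ) (hpos : 0 ≤ ψ ((1/2) ^ l * t)) :
    Real.exp (- ψ ((1/2) ^ l * t)) ≤ Real.exp (-(4:ℝ)^l) +
      ∑ j ∈ range (l + 1), 4 * (1/4:ℝ) ^ j * (if ψ ((1/2) ^ j * t) ≤ (4:ℝ)^l then (1:ℝ) else 0) := by
  have hterm : ∀ j ∈ range (l + 1), 0 ≤ 4 * (1/4:ℝ) ^ j * (if ψ ((1/2) ^ j * t) ≤ (4:ℝ)^l then (1:ℝ) else 0) := by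
    intro j _; split_ifs <;> positivity
  by_cases h : ψ ((1/2) ^ l * t) ≤ (4:ℝ)^l
  · have hex : ∃ j, ψ ((1/2) ^ j * t) ≤ (4:ℝ)^l := ⟨l, h⟩
    set j := Nat.find hex with hj
    have hj1 : ψ ((1/2) ^ j * t) ≤ (4:ℝ)^l := Nat.find_spec hex
    have hjl : j ≤ l := Nat.find_min' hex h
    have hs := Finset.single_le_sum hterm (show j ∈ range (l + 1) by simp; omega)
    rw [if_pos hj1, mul_one] at hs
    suffices Real.exp (- ψ ((1/2) ^ l * t)) ≤ 4 * (1/4:ℝ) ^ j by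
      linarith [Real.exp_pos (-(4:ℝ)^l)]
    rcases Nat.eq_zero_or_pos j with h0 | h0
    · rw [h0]
      have : Real.exp (- ψ ((1/2) ^ l * t)) ≤ 1 := Real.exp_le_one_iff.2 (by linarith)
      norm_num; linarith
    · obtain ⟨i, hi⟩ : ∃ i, j = i + 1 := ⟨j - 1, by omega⟩
      have hi1 : ¬ ψ ((1/2) ^ i * t) ≤ (4:ℝ)^l := Nat.find_min hex (by omega)
      push Not at hi1
      have hit : ∀ (m : ℕ) (s : ℝ), ψ (2 ^ m * s) ≤ 4 ^ m * ψ s := by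
        intro m s
        induction m with
        | zero => simp
        | succ m ih =>
          have := h2 (2 ^ m * s)
          rw [pow_succ, pow_succ, mul_comm (2^m) (2:ℝ), mul_assoc]
          linarith
      have h3 := hit (l - i) ((1/2) ^ l * t)
      have e : (2:ℝ) ^ (l - i) * ((1/2) ^ l * t) = (1/2) ^ i * t := by
        obtain ⟨m, rfl⟩ : ∃ m, l = i + m := ⟨l - i, by omega⟩
        have h12 : (2:ℝ) ^ m * (1/2) ^ m = 1 := by rw [← mul_pow]; norm_num
        rw [show i + m - i = m by omega, pow_add]
        linear_combination (1/2:ℝ) ^ i * t * h12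
      rw [e] at h3
      have h4 : (4:ℝ) ^ i < ψ ((1/2) ^ l * t) := by
        have : (4:ℝ) ^ l = 4 ^ (l - i) * 4 ^ i := by rw [← pow_add]; congr 1; omega
        have h5 : (4:ℝ) ^ (l - i) * 4 ^ i < 4 ^ (l - i) * ψ ((1/2) ^ l * t) := by rw [← this]; linarith
        exact lt_of_mul_lt_mul_left h5 (by positivity)
      have h6 : (4:ℝ) ^ i ≤ Real.exp (ψ ((1/2) ^ l * t)) := by
        have := Real.add_one_le_exp (ψ ((1/2) ^ l * t)); linarith
      rw [Real.exp_neg, hi]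
      have : 4 * (1/4:ℝ) ^ (i+1) = ((4:ℝ)^i)⁻¹ := by
        rw [pow_succ, one_div, inv_pow]; ring
      rw [this]
      gcongr
  · push Not at h
    have : Real.exp (- ψ ((1/2) ^ l * t)) ≤ Real.exp (-(4:ℝ)^l) := by gcongr
    have := Finset.sum_nonneg hterm
    linarith

lemma abs_cos_le_exp (x : ℝ) : |Real.cos x| ≤ Real.exp (-((1 - Real.cos (2 * x)) / 4)) := by
  have h1 : Real.cos x ^ 2 ≤ Real.exp (-((1 - Real.cos (2 * x)) / 4)) ^ 2 := by
    rw [← Real.exp_nat_mul]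
    have := Real.add_one_le_exp (((2:ℕ):ℝ) * -((1 - Real.cos (2 * x)) / 4))
    rw [Real.cos_two_mul] at this ⊢
    push_cast at this ⊢
    linarith
  exact abs_le_of_sq_le_sq h1 (Real.exp_pos _).le

lemma X_swap {n : ℕ} (w v : Fin n → ℝ) (a b : Fin n) (hab : a ≠ b) (π : Equiv.Perm (Fin n)) :
    ∑ x, w x * v ((π * Equiv.swap a b) x) = ∑ x, w x * v (π x) - (w a - w b) * (v (π a) - v (π b)) := by
  suffices ∑ x, (w x * v (π x) - w x * v ((π * Equiv.swap a b) x)) = (w a - w b) * (v (π a) - v (π b)) by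
    rw [Finset.sum_sub_distrib] at this; linarith
  rw [← Finset.sum_subset (Finset.subset_univ {a, b})]
  · rw [Finset.sum_pair hab]
    simp
    ring
  · intro x _ hx
    simp only [mem_insert, mem_singleton, not_or] at hx
    simp [Equiv.swap_apply_of_ne_of_ne hx.1 hx.2]

lemma sum_half (l : ℕ) : ∑ j ∈ range l, (1/2:ℝ) ^ j ≤ 2 := sum_geometric_two_le l

/-- Fourier bound for the cosine sum. -/
lemma cos_sum_bound {n k l : ℕ} (hk : k = 32 * 4 ^ l) (hn : 1 ≤ n) (h : 200 * k ≤ n) (a b : Fin k → Fin n)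
    (hab : Function.Injective (Sum.elim a b)) (v w : Fin n → ℝ) (Δ δ : ℝ) (hΔ : 0 < Δ) (hδ : 0 < δ) (c t : ℝ) :
    ∑ π : Equiv.Perm (Fin n), Real.cos (t * ((∑ x, w x * v (π x) - c) / (2 ^ l * δ * Δ)))
      ≤ n.factorial * (Real.exp (-(4:ℝ)^l) + ∑ j ∈ range (l + 1), 4 * (1/4:ℝ) ^ j *
        (2 * ((∑ i, Ff v ((w (a i) - w (b i)) / (δ * Δ)) ((1/2) ^ j * t)) / k) + Real.exp (-(4:ℝ) ^ l))) := by
  set z : Fin k → ℝ := fun i => (w (a i) - w (b i)) / (δ * Δ) with hz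
  have haa : ∀ i j, a i = a j → i = j := fun i j hh => by
    have := @hab (Sum.inl i) (Sum.inl j) hh; simpa using this
  have hbb : ∀ i j, b i = b j → i = j := fun i j hh => by
    have := @hab (Sum.inr i) (Sum.inr j) hh; simpa using this
  have hne : ∀ i j, a i ≠ b j := fun i j hh => by
    have := @hab (Sum.inl i) (Sum.inr j) hh; simp at this
  set x : Fin k → Equiv.Perm (Fin n) → ℝ := fun i π => (1/2) ^ l * t * (z i * (v (π (a i)) - v (π (b i)))) / 2 with hx
  have s1 := cosprod (fun i => Equiv.swap (a i) (b i)) x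
    (by
      intro i j π hij
      simp only [hx, Equiv.Perm.mul_apply]
      rw [Equiv.swap_apply_of_ne_of_ne (fun e => hij (haa _ _ e)) (hne i j),
        Equiv.swap_apply_of_ne_of_ne (hne j i).symm (fun e => hij (hbb _ _ e))])
    univ (fun π => t * ((∑ x, w x * v (π x) - c) / (2 ^ l * δ * Δ))) (fun _ => 1)
    (by
      intro i _ π
      simp only [hx, hz]
      rw [X_swap w v (a i) (b i) (hne i i)]
      rw [one_div, inv_pow]
      field_simp
      ring)
    (by intros; rfl)
  simp only [mul_one, abs_one] at s1
  refine s1.trans ?_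
  set ψ : Equiv.Perm (Fin n) → ℝ → ℝ := fun π s => ∑ i, (1 - Real.cos (s * (z i * (v (π (a i)) - v (π (b i)))))) / 4 with hψ
  have s2 : ∀ π, ∏ i, |Real.cos (x i π)| ≤ Real.exp (- ψ π ((1/2) ^ l * t)) := by
    intro π
    simp only [hψ]
    rw [← Finset.sum_neg_distrib, Real.exp_sum]
    apply Finset.prod_le_prod
    · intros; positivity
    · intro i _
      refine (abs_cos_le_exp _).trans (le_of_eq ?_)
      simp only [hx]
      congr 5
      ring
  have hψ0 : ∀ π s, 0 ≤ ψ π s := by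
    intro π s
    apply Finset.sum_nonneg
    intro i _
    have := Real.cos_le_one (s * (z i * (v (π (a i)) - v (π (b i)))))
    linarith
  have hψ2 : ∀ π s, ψ π (2 * s) ≤ 4 * ψ π s := by
    intro π s
    simp only [hψ]
    rw [Finset.mul_sum]
    apply Finset.sum_le_sum
    intro i _
    rw [mul_assoc, Real.cos_two_mul]
    nlinarith [sq_nonneg (1 - Real.cos (s * (z i * (v (π (a i)) - v (π (b i))))))]
  calc _ ≤ ∑ π, (Real.exp (-(4:ℝ)^l) +
      ∑ j ∈ range (l + 1), 4 * (1/4:ℝ) ^ j * (if ψ π ((1/2) ^ j * t) ≤ (4:ℝ)^l then (1:ℝ) else 0)) := by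
        apply Finset.sum_le_sum
        intro π _
        exact (s2 π).trans (dyadic (ψ π) (hψ2 π) l t (hψ0 π _))
    _ = n.factorial * Real.exp (-(4:ℝ)^l) + ∑ j ∈ range (l + 1), 4 * (1/4:ℝ) ^ j *
        ∑ π, (if ψ π ((1/2) ^ j * t) ≤ (4:ℝ)^l then (1:ℝ) else 0) := by
        rw [Finset.sum_add_distrib, Finset.sum_comm]
        simp only [← Finset.mul_sum]
        simp [Fintype.card_perm]
    _ ≤ n.factorial * Real.exp (-(4:ℝ)^l) + ∑ j ∈ range (l + 1), 4 * (1/4:ℝ) ^ j *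
        (n.factorial * (2 * ((∑ i, Ff v (z i) ((1/2) ^ j * t)) / k) + Real.exp (-(4:ℝ) ^ l))) := by
        gcongr with j _
        exact ind_bound hk hn h a b hab v z _
    _ = _ := by
        rw [mul_add, Finset.mul_sum]
        congr 1
        apply Finset.sum_congr rfl
        intro j _
        ring

lemma partB {n k l : ℕ} (hk : k = 32 * 4 ^ l) (hn : 1 ≤ n) (h : 200 * k ≤ n) (a b : Fin k → Fin n)
    (hab : Function.Injective (Sum.elim a b)) (v w : Fin n → ℝ) (Δ δ : ℝ) (hΔ : 0 < Δ) (hδ : 0 < δ) (c : ℝ)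
    (hv : ∀ p q : Fin n, |(p:ℝ) - (q:ℝ)| * Δ ≤ |v p - v q|)
    (hd : ∀ i, δ ≤ w (a i) - w (b i)) (hl : Real.log n ≤ (4:ℝ) ^ l) :
    ((univ.filter (fun π : Equiv.Perm (Fin n) => |∑ x, w x * v (π x) - c| ≤ 2 ^ l * δ * Δ)).card : ℝ)
      ≤ 3000 * (n.factorial / n) := by
  have hn' : (0:ℝ) < n := by exact_mod_cast hn
  have hk0 : (0:ℝ) < k := by rw [hk]; positivity
  have hr : 0 < 2 ^ l * δ * Δ := by positivity
  set r := 2 ^ l * δ * Δ with hrdef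
  set X : Equiv.Perm (Fin n) → ℝ := fun π => (∑ x, w x * v (π x) - c) / r with hX
  set z : Fin k → ℝ := fun i => (w (a i) - w (b i)) / (δ * Δ) with hz
  set G : ℝ → ℝ := fun s => (∑ i, Ff v (z i) s) / k with hG
  have hGc : Continuous G := by
    have := fun i => Ff_cont v (z i)
    simp only [hG]; fun_prop
  have hG0 : ∀ s, 0 ≤ G s := fun s => div_nonneg (Finset.sum_nonneg fun i _ => Ff_nonneg _ _ _) hk0.le
  have hGi : ∫ s in (0:ℝ)..1, G s ≤ 32 / n := by
    simp only [hG]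
    rw [intervalIntegral.integral_div, intervalIntegral.integral_finsetSum]
    · rw [div_le_iff₀ hk0]
      calc _ ≤ ∑ i : Fin k, (32:ℝ) / n := by
            apply Finset.sum_le_sum
            intro i _
            apply Ff_int hn
            intro p q
            rw [abs_mul]
            have h1 : 1 / Δ ≤ |z i| := by
              refine le_trans ?_ (le_abs_self _)
              simp only [hz]
              rw [div_le_div_iff₀ hΔ (by positivity)]
              nlinarith [hd i]
            calc _ = 1 / Δ * (|(p:ℝ) - (q:ℝ)| * Δ) := by field_simp
              _ ≤ _ := by
                gcongr
                exact hv p q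
        _ = _ := by simp; ring
    · intro i _
      exact (Ff_cont v (z i)).intervalIntegrable _ _
  have hGj : ∀ j : ℕ, ∫ t in (0:ℝ)..1, G ((1/2) ^ j * t) ≤ 2 ^ j * (32 / n) := by
    intro j
    rw [intervalIntegral.integral_comp_mul_left _ (by positivity : ((1/2:ℝ)) ^ j ≠ 0)]
    have h1 : ((1/2:ℝ)) ^ j ≤ 1 := pow_le_one₀ (by norm_num) (by norm_num)
    have h2 : ∫ s in (0:ℝ)..((1/2) ^ j), G s ≤ ∫ s in (0:ℝ)..1, G s := by
      apply intervalIntegral.integral_mono_interval le_rfl (by positivity) h1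
      · exact Filter.Eventually.of_forall fun s => hG0 s
      · exact hGc.intervalIntegrable _ _
    simp only [mul_zero, mul_one, smul_eq_mul]
    rw [one_div, inv_pow, inv_inv] at *
    gcongr
    linarith
  have hexp : Real.exp (-(4:ℝ)^l) ≤ 1 / n := by
    rw [Real.exp_neg, ← one_div]
    apply one_div_le_one_div_of_le hn'
    calc (n:ℝ) = Real.exp (Real.log n) := (Real.exp_log hn').symm
      _ ≤ _ := by gcongr
  have c1 : ((univ.filter (fun π : Equiv.Perm (Fin n) => |∑ x, w x * v (π x) - c| ≤ r)).card : ℝ)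
      ≤ 5 * ∑ π, kap (X π) := by
    rw [Finset.card_filter]
    push_cast
    rw [Finset.mul_sum]
    apply Finset.sum_le_sum
    intro π _
    split_ifs with hh
    · apply kap_lower
      simp only [hX]
      rw [abs_div, abs_of_pos hr, div_le_one hr]
      exact hh
    · linarith [kap_nonneg (X π)]
  have c2 : ∑ π, kap (X π) = ∫ t in (0:ℝ)..1, (1 - t) * ∑ π, Real.cos (t * X π) := by
    unfold kap
    rw [← intervalIntegral.integral_finsetSum]
    · simp only [Finset.mul_sum]
    · intro π _
      apply Continuous.intervalIntegrable; fun_prop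
  have c3 : ∫ t in (0:ℝ)..1, (1 - t) * ∑ π, Real.cos (t * X π) ≤
      ∫ t in (0:ℝ)..1, n.factorial * (Real.exp (-(4:ℝ)^l) + ∑ j ∈ range (l + 1), 4 * (1/4:ℝ) ^ j *
        (2 * G ((1/2) ^ j * t) + Real.exp (-(4:ℝ) ^ l))) := by
    apply intervalIntegral.integral_mono_on (by norm_num)
    · apply Continuous.intervalIntegrable; fun_prop
    · apply Continuous.intervalIntegrable; fun_prop
    · intro t ht
      have hb := cos_sum_bound hk hn h a b hab v w Δ δ hΔ hδ c t
      have hpos : 0 ≤ (n.factorial : ℝ) * (Real.exp (-(4:ℝ)^l) + ∑ j ∈ range (l + 1), 4 * (1/4:ℝ) ^ j *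
        (2 * G ((1/2) ^ j * t) + Real.exp (-(4:ℝ) ^ l))) := by
        have := fun j : ℕ => hG0 ((1/2) ^ j * t)
        apply mul_nonneg (by positivity)
        apply add_nonneg (Real.exp_pos _).le
        apply Finset.sum_nonneg
        intro j _
        have := this j
        positivity
      calc _ ≤ (1 - t) * ((n.factorial : ℝ) * (Real.exp (-(4:ℝ)^l) + ∑ j ∈ range (l + 1), 4 * (1/4:ℝ) ^ j *
        (2 * G ((1/2) ^ j * t) + Real.exp (-(4:ℝ) ^ l)))) := mul_le_mul_of_nonneg_left hb (by linarith [ht.2])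
        _ ≤ _ := by nlinarith [ht.1]
  have c4 : ∫ t in (0:ℝ)..1, n.factorial * (Real.exp (-(4:ℝ)^l) + ∑ j ∈ range (l + 1), 4 * (1/4:ℝ) ^ j *
        (2 * G ((1/2) ^ j * t) + Real.exp (-(4:ℝ) ^ l))) =
      n.factorial * (Real.exp (-(4:ℝ)^l) + ∑ j ∈ range (l + 1), 4 * (1/4:ℝ) ^ j *
        (2 * (∫ t in (0:ℝ)..1, G ((1/2) ^ j * t)) + Real.exp (-(4:ℝ) ^ l))) := by
    rw [intervalIntegral.integral_const_mul, intervalIntegral.integral_add, intervalIntegral.integral_finsetSum]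
    · congr 2
      · simp
      · apply Finset.sum_congr rfl
        intro j _
        rw [intervalIntegral.integral_const_mul, intervalIntegral.integral_add, intervalIntegral.integral_const_mul]
        · simp
        · apply Continuous.intervalIntegrable; fun_prop
        · apply Continuous.intervalIntegrable; fun_prop
    · intro j _
      apply Continuous.intervalIntegrable; fun_prop
    · apply Continuous.intervalIntegrable; fun_prop
    · apply Continuous.intervalIntegrable; fun_prop
  have c5 : ∑ j ∈ range (l + 1), 4 * (1/4:ℝ) ^ j *
        (2 * (∫ t in (0:ℝ)..1, G ((1/2) ^ j * t)) + Real.exp (-(4:ℝ) ^ l)) ≤ 520 / n := by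
    calc _ ≤ ∑ j ∈ range (l + 1), (260 / n) * (1/2:ℝ) ^ j := by
          apply Finset.sum_le_sum
          intro j _
          have e1 : (1/4:ℝ) ^ j = (1/2) ^ j * (1/2) ^ j := by rw [← mul_pow]; norm_num
          have e2 : (1/2:ℝ) ^ j * 2 ^ j = 1 := by rw [← mul_pow]; norm_num
          have e3 : (1/2:ℝ) ^ j ≤ 1 := pow_le_one₀ (by norm_num) (by norm_num)
          have e0 : (0:ℝ) < (1/2:ℝ) ^ j := by positivity
          calc _ ≤ 4 * (1/4:ℝ) ^ j * (2 * (2 ^ j * (32 / n)) + 1 / n) := by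
                gcongr
                exact hGj j
            _ = (1/2:ℝ) ^ j * (256 / n * ((1/2) ^ j * 2 ^ j) + 4 / n * (1/2) ^ j) := by rw [e1]; ring
            _ ≤ (1/2:ℝ) ^ j * (256 / n * 1 + 4 / n * 1) := by rw [e2]; gcongr
            _ = _ := by ring
      _ ≤ (260 / n) * 2 := by
          rw [← Finset.mul_sum]
          gcongr
          exact sum_half _
      _ = _ := by ring
  rw [c4] at c3
  calc _ ≤ 5 * ∑ π, kap (X π) := c1
    _ ≤ 5 * (n.factorial * (1 / n + 520 / n)) := by
      rw [c2]
      refine mul_le_mul_of_nonneg_left (c3.trans ?_) (by norm_num)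
      gcongr
    _ ≤ _ := by
      have : 0 ≤ (n.factorial : ℝ) / n := by positivity
      have e : 5 * ((n.factorial : ℝ) * (1 / n + 520 / n)) = 2605 * (n.factorial / n) := by ring
      rw [e]; linarith

lemma gapsum {m : ℕ} (f : Fin (m + 1) → ℝ) (D : ℝ) (hf : ∀ i : Fin m, f i.castSucc + D ≤ f i.succ)
    (i j : Fin (m + 1)) (hij : i ≤ j) : f i + D * ((j:ℝ) - (i:ℝ)) ≤ f j := by
  have : Monotone (fun i : Fin (m + 1) => f i - D * (i:ℝ)) := by
    rw [Fin.monotone_iff_le_succ]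
    intro i
    have := hf i
    simp only [Fin.val_castSucc, Fin.val_succ]
    push_cast
    linarith
  have := this hij
  simp only at this
  linarith

lemma partA0 {m : ℕ} (u w : Fin (m + 1) → ℝ) (Δ δ : ℝ) (hΔ : 0 < Δ) (hδ : 0 < δ) (a : Fin (m + 1))
    (hu : ∀ i : Fin m, u i.castSucc + Δ ≤ u i.succ) (hw : ∀ b, b ≠ a → w b + δ ≤ w a) (c : ℝ) :
    (univ.filter (fun g : Equiv.Perm (Fin (m + 1)) => |∑ x, u x * w (g x) - c| ≤ δ * Δ / 3)).card ≤ m.factorial := by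
  set P : Equiv.Perm (Fin (m + 1)) → Prop := fun g => |∑ x, u x * w (g x) - c| ≤ δ * Δ / 3 with hP
  have h1 : ∀ h : Equiv.Perm (Fin (m + 1)), h 0 = a →
      (univ.filter (fun j : Fin (m + 1) => P (h * Fin.cycleRange j))).card ≤ 1 := by
    intro h h0
    have hg := gapsum (fun j => ∑ x, u x * w ((h * Fin.cycleRange j : Equiv.Perm (Fin (m + 1))) x)) (δ * Δ) (by
      intro i
      have e : Fin.cycleRange i.succ = Fin.cycleRange i.castSucc * Equiv.swap i.castSucc i.succ := by
        ext x
        rw [Equiv.Perm.mul_apply]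
        rcases lt_trichotomy x i.castSucc with hx | hx | hx
        · rw [Equiv.swap_apply_of_ne_of_ne hx.ne (hx.trans Fin.castSucc_lt_succ).ne,
            Fin.cycleRange_of_lt hx, Fin.cycleRange_of_lt (hx.trans Fin.castSucc_lt_succ)]
        · subst hx
          rw [Equiv.swap_apply_left, Fin.cycleRange_of_lt Fin.castSucc_lt_succ,
            Fin.cycleRange_of_gt Fin.castSucc_lt_succ]
          simp
        · rcases eq_or_lt_of_le (show i.succ ≤ x from Fin.castSucc_lt_iff_succ_le.1 hx) with hx2 | hx2
          · subst hx2
            rw [Equiv.swap_apply_right, Fin.cycleRange_self, Fin.cycleRange_self]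
          · rw [Equiv.swap_apply_of_ne_of_ne hx.ne' hx2.ne', Fin.cycleRange_of_gt hx, Fin.cycleRange_of_gt hx2]
      simp only [e, ← mul_assoc]
      rw [X_swap u w _ _ Fin.castSucc_lt_succ.ne]
      have e1 : (h * Fin.cycleRange i.castSucc) i.castSucc = a := by
        rw [Equiv.Perm.mul_apply, Fin.cycleRange_self, h0]
      have e2 : (h * Fin.cycleRange i.castSucc) i.succ = h i.succ := by
        rw [Equiv.Perm.mul_apply, Fin.cycleRange_of_gt Fin.castSucc_lt_succ]
      rw [e1, e2]
      have hne : h i.succ ≠ a := by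
        rw [← h0]; intro hh
        exact Fin.succ_ne_zero _ (h.injective hh)
      have i1 := hw _ hne
      have i2 := hu i
      nlinarith [mul_nonneg (by linarith : 0 ≤ w a - w (h i.succ) - δ) (by linarith : 0 ≤ u i.succ - u i.castSucc),
        mul_nonneg hδ.le (by linarith : 0 ≤ u i.succ - u i.castSucc - Δ)])
    have hlt : ∀ i j : Fin (m + 1), i < j → P (h * Fin.cycleRange i) → P (h * Fin.cycleRange j) → False := by
      intro i j hij hi hj
      have hh := hg i j hij.le
      simp only [hP] at hi hj
      have h3 : (1:ℝ) ≤ (j:ℝ) - (i:ℝ) := by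
        have : (i:ℕ) + 1 ≤ (j:ℕ) := hij
        have : ((i:ℕ):ℝ) + 1 ≤ ((j:ℕ):ℝ) := by exact_mod_cast this
        linarith
      have hD : 0 < δ * Δ := by positivity
      rw [abs_le] at hi hj
      nlinarith [mul_le_mul_of_nonneg_left h3 hD.le]
    rw [Finset.card_le_one]
    intro i hi j hj
    simp only [mem_filter, mem_univ, true_and] at hi hj
    rcases lt_trichotomy i j with hh | hh | hh
    · exact (hlt i j hh hi hj).elim
    · exact hh
    · exact (hlt j i hh hj hi).elim
  have h2 : (univ.filter (fun h : Equiv.Perm (Fin (m + 1)) => h 0 = a)).card ≤ m.factorial := by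
    have := fiber_card (κ := Unit) (fun _ => (0 : Fin (m + 1))) (fun _ _ _ => rfl) (fun _ => a)
    simpa using this
  calc (univ.filter P).card = ∑ g, if P g then 1 else 0 := by rw [Finset.card_filter]
    _ ≤ ∑ g : Equiv.Perm (Fin (m + 1)), ∑ j, if g j = a ∧ P g then 1 else 0 := by
        apply Finset.sum_le_sum
        intro g _
        split_ifs with hg
        · refine le_trans ?_ (Finset.single_le_sum (fun _ _ => Nat.zero_le _) (mem_univ (g.symm a)))
          simp [hg]
        · exact Nat.zero_le _
    _ = ∑ j, ∑ g : Equiv.Perm (Fin (m + 1)), if g j = a ∧ P g then 1 else 0 := Finset.sum_comm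
    _ = ∑ j, ∑ h : Equiv.Perm (Fin (m + 1)), if h 0 = a ∧ P (h * Fin.cycleRange j) then 1 else 0 := by
        apply Finset.sum_congr rfl
        intro j _
        rw [← Equiv.sum_comp (Equiv.mulRight (Fin.cycleRange j))]
        simp
    _ = ∑ h : Equiv.Perm (Fin (m + 1)), ∑ j, if h 0 = a ∧ P (h * Fin.cycleRange j) then 1 else 0 := Finset.sum_comm
    _ ≤ ∑ h : Equiv.Perm (Fin (m + 1)), if h 0 = a then 1 else 0 := by
        apply Finset.sum_le_sum
        intro h _
        by_cases h0 : h 0 = a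
        · simp only [h0, true_and, if_true]
          rw [← Finset.card_filter]
          exact h1 h h0
        · simp [h0]
    _ = _ := by rw [← Finset.card_filter]
    _ ≤ _ := h2

lemma partA1 {m : ℕ} (u y : Fin (m + 1) → ℝ) (Δ δ : ℝ) (hΔ : 0 < Δ) (hδ : 0 < δ) (a : Fin (m + 1))
    (hu : ∀ i j, i ≠ j → Δ ≤ |u i - u j|) (hw : ∀ b, b ≠ a → y b + δ ≤ y a) (c : ℝ) :
    (univ.filter (fun g : Equiv.Perm (Fin (m + 1)) => |∑ x, y x * u (g x) - c| ≤ δ * Δ / 3)).card ≤ m.factorial := by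
  set τ := Tuple.sort u with hτ
  have hmono : Monotone (u ∘ τ) := Tuple.monotone_sort u
  refine le_trans ?_ (partA0 (u ∘ τ) y Δ δ hΔ hδ a ?_ hw c)
  · apply Finset.card_le_card_of_injOn (fun ρ => ρ⁻¹ * τ)
    · intro ρ hρ
      simp only [coe_filter, mem_univ, true_and, Set.mem_ofPred_eq] at hρ ⊢
      have : ∑ x, (u ∘ τ) x * y ((ρ⁻¹ * τ) x) = ∑ x, y x * u (ρ x) := by
        rw [← Equiv.sum_comp (ρ⁻¹ * τ) (fun x => y x * u (ρ x))]
        apply Finset.sum_congr rfl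
        intro x _
        simp [mul_comm]
      rw [this]; exact hρ
    · intro ρ _ ρ' _ hh
      simpa using hh
  · intro i
    have h1 := hmono (Fin.castSucc_lt_succ (i := i)).le
    have h2 := hu (τ i.succ) (τ i.castSucc) (fun hh => (Fin.castSucc_lt_succ (i := i)).ne' (τ.injective hh))
    simp only [Function.comp] at h1 ⊢
    rw [abs_of_nonneg (by linarith)] at h2
    linarith

lemma partA2 {n m : ℕ} (w v : Fin n → ℝ) (Δ δ : ℝ) (hΔ : 0 < Δ) (hδ : 0 < δ) (e : Fin (m + 1) ↪ Fin n) (a : Fin (m + 1))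
    (hv : ∀ i j, i ≠ j → Δ ≤ |v i - v j|) (hw : ∀ b, b ≠ a → w (e b) + δ ≤ w (e a)) (c : ℝ) :
    (univ.filter (fun π : Equiv.Perm (Fin n) => |∑ x, w x * v (π x) - c| ≤ δ * Δ / 3)).card * (m + 1) ≤ n.factorial := by
  set P : Equiv.Perm (Fin n) → Prop := fun π => |∑ x, w x * v (π x) - c| ≤ δ * Δ / 3 with hP
  have h1 : ∀ π : Equiv.Perm (Fin n), (univ.filter (fun ρ : Equiv.Perm (Fin (m + 1)) => P (π * ρ.viaFintypeEmbedding e))).card ≤ m.factorial := by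
    intro π
    have hsplit : ∀ ρ : Equiv.Perm (Fin (m + 1)), ∑ x, w x * v ((π * ρ.viaFintypeEmbedding e) x)
        = ∑ x ∈ univ.filter (fun x => x ∉ Set.range e), w x * v (π x) + ∑ i, w (e i) * v (π (e (ρ i))) := by
      intro ρ
      rw [← Finset.sum_filter_not_add_sum_filter univ (fun x => x ∈ Set.range e)]
      congr 1
      · apply Finset.sum_congr rfl
        intro x hx
        rw [Equiv.Perm.mul_apply, Equiv.Perm.viaFintypeEmbedding_apply_notMem_range _ _ (by simpa using hx)]
      · have : univ.filter (fun x => x ∈ Set.range e) = univ.map e := by ext; simp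
        rw [this, Finset.sum_map]
        simp
    refine le_trans (le_of_eq ?_) (partA1 (fun i => v (π (e i))) (fun i => w (e i)) Δ δ hΔ hδ a
      (fun i j hij => hv _ _ (fun hh => hij (e.injective (π.injective hh)))) hw
      (c - ∑ x ∈ univ.filter (fun x => x ∉ Set.range e), w x * v (π x)))
    congr 1
    ext ρ
    simp only [hP, mem_filter, mem_univ, true_and]
    rw [hsplit]
    rw [show ∀ p q : ℝ, p + q - c = q - (c - p) by intros; ring]
  have h2 : (univ.filter P).card * (m + 1).factorial ≤ n.factorial * m.factorial := by
    calc (univ.filter P).card * (m + 1).factorial = ∑ ρ : Equiv.Perm (Fin (m + 1)), ∑ π, if P π then 1 else 0 := by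
          rw [Finset.card_filter, Finset.sum_const, Finset.card_univ, Fintype.card_perm, Fintype.card_fin, smul_eq_mul, mul_comm]
      _ = ∑ ρ : Equiv.Perm (Fin (m + 1)), ∑ π, if P (π * ρ.viaFintypeEmbedding e) then 1 else 0 := by
          apply Finset.sum_congr rfl
          intro ρ _
          exact (Equiv.sum_comp (Equiv.mulRight (ρ.viaFintypeEmbedding e)) (fun π => if P π then 1 else 0)).symm
      _ = ∑ π, ∑ ρ : Equiv.Perm (Fin (m + 1)), if P (π * ρ.viaFintypeEmbedding e) then 1 else 0 := Finset.sum_comm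
      _ ≤ ∑ π : Equiv.Perm (Fin n), m.factorial := by
          apply Finset.sum_le_sum
          intro π _
          rw [← Finset.card_filter]
          exact h1 π
      _ = _ := by simp [Fintype.card_perm]
  rw [Nat.factorial_succ, ← mul_assoc] at h2
  exact Nat.le_of_mul_le_mul_right h2 (Nat.factorial_pos m)

lemma useA {n : ℕ} (hn : 3 ≤ n) (w v : Fin n → ℝ) (Δ : ℝ) (hΔ : 0 < Δ) (hw : Monotone w)
    (hv : ∀ i j, i ≠ j → Δ ≤ |v i - v j|) (c : ℝ)
    (hD : 0 < w ⟨n - 1, by omega⟩ - w ⟨0, by omega⟩) :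
    ((univ.filter (fun π : Equiv.Perm (Fin n) => |∑ x, w x * v (π x) - c| ≤
      (w ⟨n - 1, by omega⟩ - w ⟨0, by omega⟩) / 2 * Δ / 3)).card : ℝ) ≤ 2 * (n.factorial / n) := by
  set D := w ⟨n - 1, by omega⟩ - w ⟨0, by omega⟩ with hDdef
  suffices hs : (univ.filter (fun π : Equiv.Perm (Fin n) => |∑ x, w x * v (π x) - c| ≤ D / 2 * Δ / 3)).card * (n / 2 + 1) ≤ n.factorial by
    have h1 : ((univ.filter (fun π : Equiv.Perm (Fin n) => |∑ x, w x * v (π x) - c| ≤ D / 2 * Δ / 3)).card : ℝ) * (((n / 2 : ℕ) : ℝ) + 1) ≤ n.factorial := by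
      exact_mod_cast hs
    have hn' : (0:ℝ) < n := by exact_mod_cast (by omega : 0 < n)
    have h2 : (n:ℝ) / 2 ≤ ((n / 2 : ℕ) : ℝ) + 1 := by
      have : n ≤ 2 * (n / 2 + 1) := by omega
      have : (n:ℝ) ≤ 2 * (((n / 2 : ℕ) : ℝ) + 1) := by exact_mod_cast this
      linarith
    rw [← mul_div_assoc, le_div_iff₀ hn']
    nlinarith [mul_le_mul_of_nonneg_left h2 (Nat.cast_nonneg (α := ℝ) (univ.filter (fun π : Equiv.Perm (Fin n) => |∑ x, w x * v (π x) - c| ≤ D / 2 * Δ / 3)).card)]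
  by_cases hc : D / 2 ≤ w ⟨n - 1, by omega⟩ - w ⟨n / 2, by omega⟩
  · let e : Fin (n / 2 + 1) ↪ Fin n := ⟨fun i => if h : (i:ℕ) < n / 2 then ⟨i, by omega⟩ else ⟨n - 1, by omega⟩, by
      intro i j hij
      simp only at hij
      ext
      split_ifs at hij with h1 h2 h2 <;> simp only [Fin.mk.injEq] at hij <;> omega⟩
    apply partA2 w v Δ (D / 2) hΔ (by linarith) e (Fin.last _) hv
    intro b hb
    have hb' : (b:ℕ) < n / 2 := by
      have := Fin.val_lt_last hb; simpa using this
    have e1 : e b = ⟨b, by omega⟩ := dif_pos hb'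
    have e2 : e (Fin.last _) = ⟨n - 1, by omega⟩ := dif_neg (by simp)
    rw [e1, e2]
    have : w ⟨b, by omega⟩ ≤ w ⟨n / 2, by omega⟩ := hw (by simp only [Fin.mk_le_mk]; omega)
    linarith
  · push Not at hc
    let e : Fin (n / 2 + 1) ↪ Fin n := ⟨fun i => if h : (i:ℕ) < n / 2 then ⟨n - 1 - i, by omega⟩ else ⟨0, by omega⟩, by
      intro i j hij
      simp only at hij
      ext
      split_ifs at hij with h1 h2 h2 <;> simp only [Fin.mk.injEq] at hij <;> omega⟩
    have := partA2 (fun x => - w x) v Δ (D / 2) hΔ (by linarith) e (Fin.last _) hv (by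
      intro b hb
      have hb' : (b:ℕ) < n / 2 := by
        have := Fin.val_lt_last hb; simpa using this
      have e1 : e b = ⟨n - 1 - b, by omega⟩ := dif_pos hb'
      have e2 : e (Fin.last _) = ⟨0, by omega⟩ := dif_neg (by simp)
      rw [e1, e2]
      have : w ⟨n / 2, by omega⟩ ≤ w ⟨n - 1 - b, by omega⟩ := hw (by simp only [Fin.mk_le_mk]; omega)
      linarith) (-c)
    convert this using 4
    rw [← abs_neg (_ - c)]
    simp only [neg_mul, Finset.sum_neg_distrib]
    rw [show ∀ p : ℝ, -(p - c) = -p - -c by intros; ring]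

lemma useB {n : ℕ} (hn : 3 ≤ n) (w v : Fin n → ℝ) (Δ : ℝ) (hΔ : 0 < Δ) (hw : Monotone w)
    (hv : ∀ p q : Fin n, |(p:ℝ) - (q:ℝ)| * Δ ≤ |v p - v q|) (c : ℝ) (j : ℕ) (hj : 2 * (j + 1) ≤ n)
    (hlog : 12800 * Real.log n ≤ (j:ℝ) + 1)
    (hD : 0 < w ⟨n - 1 - j, by omega⟩ - w ⟨j, by omega⟩) (r : ℝ)
    (hr : 12800 * r ^ 2 ≤ ((j:ℝ) + 1) * (w ⟨n - 1 - j, by omega⟩ - w ⟨j, by omega⟩) ^ 2 * Δ ^ 2) :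
    ((univ.filter (fun π : Equiv.Perm (Fin n) => |∑ x, w x * v (π x) - c| ≤ r)).card : ℝ) ≤ 3000 * (n.factorial / n) := by
  set D := w ⟨n - 1 - j, by omega⟩ - w ⟨j, by omega⟩ with hDdef
  have hlog1 : 1 ≤ Real.log n := by
    rw [Real.le_log_iff_exp_le (by exact_mod_cast (by omega : 0 < n))]
    have := Real.exp_one_lt_d9
    have h3 : (3:ℝ) ≤ n := by exact_mod_cast hn
    linarith
  have hj2 : 3200 ≤ j + 1 := by
    have : (3200:ℝ) ≤ (j:ℝ) + 1 := by linarith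
    exact_mod_cast this
  set l := Nat.log 4 ((j + 1) / 3200) with hl
  have hl1 : 4 ^ l ≤ (j + 1) / 3200 := Nat.pow_log_le_self 4 (by omega)
  have hl2 : (j + 1) / 3200 < 4 ^ (l + 1) := Nat.lt_pow_succ_log_self (by norm_num) _
  have hl3 : j + 1 < 12800 * 4 ^ l := by rw [pow_succ] at hl2; omega
  have hl3' : (j:ℝ) + 1 ≤ 12800 * 4 ^ l := by exact_mod_cast hl3.le
  have hkj : 32 * 4 ^ l ≤ j := by omega
  have hB := partB (n := n) (k := 32 * 4 ^ l) (l := l) rfl (by omega) (by omega)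
    (fun i => ⟨n - 1 - i, by omega⟩) (fun i => ⟨i, by omega⟩)
    (by
      intro x y hxy
      rcases x with x | x <;> rcases y with y | y <;> simp only [Sum.elim_inl, Sum.elim_inr, Fin.mk.injEq] at hxy
      · congr 1; ext; omega
      · omega
      · omega
      · congr 1; ext; omega) v w Δ D hΔ hD c hv
    (by
      intro i
      have h1 : w ⟨n - 1 - j, by omega⟩ ≤ w ⟨n - 1 - i, by omega⟩ := hw (by simp only [Fin.mk_le_mk]; omega)
      have h2 : w ⟨i, by omega⟩ ≤ w ⟨j, by omega⟩ := hw (by simp only [Fin.mk_le_mk]; omega)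
      simp only [hDdef]
      linarith) (by linarith)
  refine le_trans ?_ hB
  have hrr : r ≤ 2 ^ l * D * Δ := by
    apply le_of_sq_le_sq _ (by positivity)
    have : (2 ^ l * D * Δ) ^ 2 = 4 ^ l * (D ^ 2 * Δ ^ 2) := by
      rw [mul_pow, mul_pow, ← pow_mul, mul_comm l 2, pow_mul]; norm_num; ring
    rw [this]
    have h5 : 0 ≤ D ^ 2 * Δ ^ 2 := by positivity
    have h6 := mul_le_mul_of_nonneg_right hl3' h5
    rw [mul_assoc] at hr h6
    have h7 : 12800 * r ^ 2 ≤ 12800 * (4 ^ l * (D ^ 2 * Δ ^ 2)) := hr.trans h6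
    exact le_of_mul_le_mul_left h7 (by norm_num)
  gcongr

lemma var_le {n : ℕ} (hn : 1 ≤ n) (w : Fin n → ℝ) (μ : ℝ) :
    ∑ i, (w i - (∑ j, w j) / n) ^ 2 ≤ ∑ i, (w i - μ) ^ 2 := by
  have hn' : (0:ℝ) < n := by exact_mod_cast hn
  set m := (∑ j, w j) / n with hm
  have h1 : ∑ j, w j = n * m := by rw [hm]; field_simp
  have h2 : ∑ i, (w i - μ) ^ 2 = ∑ i, (w i - m) ^ 2 + n * (m - μ) ^ 2 := by
    have : ∀ i, (w i - μ) ^ 2 = (w i - m) ^ 2 + (2 * (m - μ) * w i + ((m - μ) ^ 2 - 2 * (m - μ) * m)) := by intro i; ring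
    simp_rw [this]
    rw [Finset.sum_add_distrib, Finset.sum_add_distrib, ← Finset.mul_sum, h1]
    simp
    ring
  rw [h2]
  have : 0 ≤ n * (m - μ) ^ 2 := by positivity
  linarith

lemma sorted_conc {n : ℕ} (hn : 3 ≤ n) (w v : Fin n → ℝ) (Δ σ : ℝ) (hΔ : 0 < Δ) (hw : Monotone w)
    (hv1 : ∀ i j, i ≠ j → Δ ≤ |v i - v j|)
    (hv : ∀ p q : Fin n, |(p:ℝ) - (q:ℝ)| * Δ ≤ |v p - v q|) (hσ0 : 0 < σ)
    (hσ : σ ^ 2 = ∑ i, (w i - (∑ j, w j) / n) ^ 2) (c : ℝ) :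
    ((univ.filter (fun π : Equiv.Perm (Fin n) => |∑ x, w x * v (π x) - c| ≤ σ * Δ / (1000 * Real.sqrt (Real.log n)))).card : ℝ)
      ≤ 3000 * (n.factorial / n) := by
  have hn' : (0:ℝ) < n := by exact_mod_cast (by omega : 0 < n)
  have hlog1 : 1 ≤ Real.log n := by
    rw [Real.le_log_iff_exp_le hn']
    have := Real.exp_one_lt_d9
    have h3 : (3:ℝ) ≤ n := by exact_mod_cast hn
    linarith
  have hsq : 0 < Real.sqrt (Real.log n) := Real.sqrt_pos.2 (by linarith)
  set r := σ * Δ / (1000 * Real.sqrt (Real.log n)) with hr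
  have hr0 : 0 < r := by positivity
  set L := Real.log n with hL
  have hr2 : r ^ 2 * (1000000 * L) = σ ^ 2 * Δ ^ 2 := by
    have : Real.sqrt L ^ 2 = L := Real.sq_sqrt (by linarith)
    rw [hr, div_pow, mul_pow, mul_pow, this]
    field_simp
    norm_num
  by_contra hcon
  set ρ := r ^ 2 / Δ ^ 2 with hρ
  have hρ0 : 0 < ρ := by positivity
  have hρr : ρ * Δ ^ 2 = r ^ 2 := by rw [hρ]; field_simp
  have hρσ : ρ * (1000000 * L) = σ ^ 2 := by
    have : ρ * (1000000 * L) * Δ ^ 2 = σ ^ 2 * Δ ^ 2 := by rw [← hr2, ← hρr]; ring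
    exact mul_right_cancel₀ (by positivity) this
  have hA : (w ⟨n - 1, by omega⟩ - w ⟨0, by omega⟩) ^ 2 ≤ 36 * ρ := by
    by_contra h
    push Not at h
    have h0 : 0 ≤ w ⟨n - 1, by omega⟩ - w ⟨0, by omega⟩ :=
      sub_nonneg.2 (hw (by simp only [Fin.mk_le_mk]; omega))
    have h1 : 0 < w ⟨n - 1, by omega⟩ - w ⟨0, by omega⟩ := by
      rcases h0.lt_or_eq with h1 | h1
      · exact h1
      · rw [← h1] at h; nlinarith
    apply hcon
    refine le_trans ?_ ((useA hn w v Δ hΔ hw hv1 c h1).trans ?_)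
    · have : r ≤ (w ⟨n - 1, by omega⟩ - w ⟨0, by omega⟩) / 2 * Δ / 3 := by
        apply le_of_sq_le_sq _ (by positivity)
        have h5 : 0 < Δ ^ 2 := by positivity
        nlinarith [mul_lt_mul_of_pos_right h h5]
      gcongr
    · have : 0 ≤ (n.factorial : ℝ) / n := by positivity
      linarith
  set g : ℕ → ℝ := fun j => (if (j:ℝ) + 1 < 12800 * L then 36 * ρ else 0) + 12800 * ρ * (1 / ((j:ℝ) + 1)) with hg
  have hg0 : ∀ j, 0 ≤ g j := by
    intro j; simp only [hg]; split_ifs <;> positivity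
  have hB : ∀ j, (hj : 2 * (j + 1) ≤ n) → (w ⟨n - 1 - j, by omega⟩ - w ⟨j, by omega⟩) ^ 2 ≤ g j := by
    intro j hj
    have h0 : 0 ≤ w ⟨n - 1 - j, by omega⟩ - w ⟨j, by omega⟩ :=
      sub_nonneg.2 (hw (by simp only [Fin.mk_le_mk]; omega))
    have hp : 0 ≤ 12800 * ρ * (1 / ((j:ℝ) + 1)) := by positivity
    by_cases hc : (j:ℝ) + 1 < 12800 * L
    · simp only [hg, if_pos hc]
      have h1 : w ⟨n - 1 - j, by omega⟩ ≤ w ⟨n - 1, by omega⟩ := hw (by simp only [Fin.mk_le_mk]; omega)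
      have h2 : w ⟨0, by omega⟩ ≤ w ⟨j, by omega⟩ := hw (by simp only [Fin.mk_le_mk]; omega)
      have h3 : (w ⟨n - 1 - j, by omega⟩ - w ⟨j, by omega⟩) ^ 2 ≤ (w ⟨n - 1, by omega⟩ - w ⟨0, by omega⟩) ^ 2 := by
        apply pow_le_pow_left₀ h0; linarith
      linarith
    · simp only [hg, if_neg hc, zero_add]
      by_contra h
      push Not at h hc
      have h1 : 0 < w ⟨n - 1 - j, by omega⟩ - w ⟨j, by omega⟩ := by
        rcases h0.lt_or_eq with h1 | h1
        · exact h1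
        · rw [← h1, zero_pow two_ne_zero] at h; linarith
      apply hcon
      apply useB hn w v Δ hΔ hw hv c j hj hc h1
      have hj1 : (0:ℝ) < (j:ℝ) + 1 := by positivity
      rw [mul_one_div, div_lt_iff₀ hj1] at h
      have h5 : 0 < Δ ^ 2 := by positivity
      have := mul_lt_mul_of_pos_right h h5
      rw [← hρr]
      linarith
  have hpair : ∀ i : Fin n, (w i - w i.rev) ^ 2 ≤ g i + g i.rev := by
    intro i
    obtain ⟨i, hi⟩ := i
    have hrev : (Fin.rev ⟨i, hi⟩ : Fin n) = ⟨n - 1 - i, by omega⟩ := by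
      ext; simp [Fin.rev]; omega
    rw [hrev]
    have g1 := hg0 i
    have g2 := hg0 (n - 1 - i)
    rcases lt_trichotomy i (n - 1 - i) with h | h | h
    · have := hB i (by omega)
      simp only
      nlinarith
    · have : (⟨n - 1 - i, by omega⟩ : Fin n) = ⟨i, hi⟩ := by ext; simp only; omega
      rw [this]
      simp only [sub_self]
      nlinarith
    · have := hB (n - 1 - i) (by omega)
      have e : (⟨n - 1 - (n - 1 - i), by omega⟩ : Fin n) = ⟨i, hi⟩ := by ext; simp only; omega
      rw [e] at this
      simp only
      linarith
  have hmed : ∀ i : Fin n, (w i - w ⟨n / 2, by omega⟩) ^ 2 + (w i.rev - w ⟨n / 2, by omega⟩) ^ 2 ≤ (w i - w i.rev) ^ 2 := by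
    intro i
    obtain ⟨i, hi⟩ := i
    have hrev : (Fin.rev ⟨i, hi⟩ : Fin n) = ⟨n - 1 - i, by omega⟩ := by
      ext; simp [Fin.rev]; omega
    rw [hrev]
    by_cases h : i < n / 2
    · have h1 : w ⟨i, hi⟩ ≤ w ⟨n / 2, by omega⟩ := hw (by simp only [Fin.mk_le_mk]; omega)
      have h2 : w ⟨n / 2, by omega⟩ ≤ w ⟨n - 1 - i, by omega⟩ := hw (by simp only [Fin.mk_le_mk]; omega)
      nlinarith [mul_nonneg (sub_nonneg.2 h1) (sub_nonneg.2 h2)]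
    · have h1 : w ⟨n / 2, by omega⟩ ≤ w ⟨i, hi⟩ := hw (by simp only [Fin.mk_le_mk]; omega)
      have h2 : w ⟨n - 1 - i, by omega⟩ ≤ w ⟨n / 2, by omega⟩ := hw (by simp only [Fin.mk_le_mk]; omega)
      nlinarith [mul_nonneg (sub_nonneg.2 h1) (sub_nonneg.2 h2)]
  have hsum : 2 * σ ^ 2 ≤ 2 * ∑ i : Fin n, g i := by
    have hv2 := var_le (by omega) w (w ⟨n / 2, by omega⟩)
    have r1 : ∑ i : Fin n, (w i.rev - w ⟨n / 2, by omega⟩) ^ 2 = ∑ i : Fin n, (w i - w ⟨n / 2, by omega⟩) ^ 2 :=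
      Equiv.sum_comp Fin.revPerm (fun i => (w i - w ⟨n / 2, by omega⟩) ^ 2)
    have r2 : ∑ i : Fin n, g i.rev = ∑ i : Fin n, g i := Equiv.sum_comp Fin.revPerm (fun i : Fin n => g i)
    calc 2 * σ ^ 2 ≤ ∑ i : Fin n, ((w i - w ⟨n / 2, by omega⟩) ^ 2 + (w i.rev - w ⟨n / 2, by omega⟩) ^ 2) := by
          rw [Finset.sum_add_distrib, r1, hσ]; linarith
      _ ≤ ∑ i : Fin n, (g i + g i.rev) := Finset.sum_le_sum fun i _ => (hmed i).trans (hpair i)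
      _ = _ := by rw [Finset.sum_add_distrib, r2]; ring
  have hharm : ∑ i ∈ range n, 1 / ((i:ℝ) + 1) ≤ 1 + L := by
    have h1 := harmonic_le_one_add_log n
    have h2 : ((harmonic n : ℚ) : ℝ) = ∑ i ∈ range n, 1 / ((i:ℝ) + 1) := by
      unfold harmonic; push_cast; simp
    rw [← h2]; exact h1
  have hcnt : ∑ i ∈ range n, (if (i:ℝ) + 1 < 12800 * L then 36 * ρ else 0) ≤ 12800 * L * (36 * ρ) := by
    rw [← Finset.sum_filter, Finset.sum_const, nsmul_eq_mul]
    gcongr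
    have : ((range n).filter (fun i : ℕ => (i:ℝ) + 1 < 12800 * L)) ⊆ range ⌊12800 * L⌋₊ := by
      intro i hi
      have h1 := (Finset.mem_filter.1 hi).2
      rw [Finset.mem_range]
      apply Nat.lt_of_succ_le
      apply Nat.le_floor
      push_cast
      exact h1.le
    have h2 := Finset.card_le_card this
    rw [Finset.card_range] at h2
    calc _ ≤ ((⌊12800 * L⌋₊ : ℕ) : ℝ) := by exact_mod_cast h2
      _ ≤ _ := Nat.floor_le (by linarith)
  have hfin : ∑ i : Fin n, g i ≤ 12800 * L * (36 * ρ) + 12800 * ρ * (1 + L) := by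
    rw [Fin.sum_univ_eq_sum_range]
    simp only [hg]
    rw [Finset.sum_add_distrib, ← Finset.mul_sum]
    gcongr
  nlinarith [mul_le_mul_of_nonneg_left hlog1 hρ0.le, mul_pos hρ0 (by linarith : 0 < L)]

lemma conc {n : ℕ} (hn : 3 ≤ n) (w v : Fin n → ℝ) (Δ σ : ℝ) (hΔ : 0 < Δ)
    (hv1 : ∀ i j, i ≠ j → Δ ≤ |v i - v j|) (hσ0 : 0 < σ)
    (hσ : σ ^ 2 = ∑ i, (w i - (∑ j, w j) / n) ^ 2) (c : ℝ) :
    ((univ.filter (fun π : Equiv.Perm (Fin n) => |∑ i, w (π i) * v i - c| ≤ σ * Δ / (1000 * Real.sqrt (Real.log n)))).card : ℝ)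
      ≤ 3000 * (n.factorial / n) := by
  set τ := Tuple.sort w with hτ
  set κ := Tuple.sort v with hκ
  have hw' : Monotone (w ∘ τ) := Tuple.monotone_sort w
  have hv' : Monotone (v ∘ κ) := Tuple.monotone_sort v
  have hv1' : ∀ i j, i ≠ j → Δ ≤ |(v ∘ κ) i - (v ∘ κ) j| := fun i j hij =>
    hv1 _ _ (fun h => hij (κ.injective h))
  have hgap : ∀ p q : Fin n, p ≤ q → (v ∘ κ) p + Δ * ((q:ℝ) - (p:ℝ)) ≤ (v ∘ κ) q := by
    obtain ⟨m, rfl⟩ : ∃ m, n = m + 1 := ⟨n - 1, by omega⟩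
    apply gapsum
    intro i
    have h1 := hv' (Fin.castSucc_lt_succ (i := i)).le
    have h2 := hv1' i.succ i.castSucc (Fin.castSucc_lt_succ (i := i)).ne'
    rw [abs_of_nonneg (by linarith)] at h2
    linarith
  have hv2' : ∀ p q : Fin n, |(p:ℝ) - (q:ℝ)| * Δ ≤ |(v ∘ κ) p - (v ∘ κ) q| := by
    have key : ∀ p q : Fin n, p ≤ q → |(p:ℝ) - (q:ℝ)| * Δ ≤ |(v ∘ κ) p - (v ∘ κ) q| := by
      intro p q hpq
      have h1 := hgap p q hpq
      have h2 : (p:ℝ) ≤ (q:ℝ) := by exact_mod_cast hpq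
      rw [abs_sub_comm, abs_of_nonneg (by linarith : 0 ≤ (q:ℝ) - p), abs_sub_comm]
      refine le_trans ?_ (le_abs_self _)
      linarith
    intro p q
    rcases le_total p q with h | h
    · exact key p q h
    · rw [abs_sub_comm, abs_sub_comm ((v ∘ κ) p)]; exact key q p h
  have hσ' : σ ^ 2 = ∑ i, ((w ∘ τ) i - (∑ j, (w ∘ τ) j) / n) ^ 2 := by
    have e1 : ∑ j, (w ∘ τ) j = ∑ j, w j := Equiv.sum_comp τ w
    rw [e1, hσ]
    exact (Equiv.sum_comp τ (fun i => (w i - (∑ j, w j) / n) ^ 2)).symm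
  refine le_trans ?_ (sorted_conc hn (w ∘ τ) (v ∘ κ) Δ σ hΔ hw' hv1' hv2' hσ0 hσ' c)
  apply Nat.cast_le.2
  apply Finset.card_le_card_of_injOn (fun π => κ⁻¹ * π⁻¹ * τ)
  · intro π hπ
    simp only [coe_filter, mem_univ, true_and, Set.mem_ofPred_eq] at hπ ⊢
    have : ∑ x, (w ∘ τ) x * (v ∘ κ) ((κ⁻¹ * π⁻¹ * τ) x) = ∑ i, w (π i) * v i := by
      rw [← Equiv.sum_comp (π⁻¹ * τ) (fun i => w (π i) * v i)]
      apply Finset.sum_congr rfl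
      intro x _
      simp
    rw [this]; exact hπ
  · intro π _ π' _ hh
    simpa using hh

theorem stmt_5 :
    ∃ C : ℝ, 0 < C ∧ ∀ (n : ℕ) (w v : Fin n → ℝ) (Δ σ : ℝ),
      0 < Δ → (∀ i j : Fin n, i ≠ j → Δ ≤ |v i - v j|) →
      σ = Real.sqrt (∑ i, (w i - (∑ j, w j) / n) ^ 2) → 0 < σ →
      ∀ a b : ℝ, a ≤ b →
        ((Finset.univ.filter (fun π : Equiv.Perm (Fin n) =>
            (∑ i, w (π i) * v i) ∈ Set.Icc a b)).card : ℝ) / (Nat.factorial n : ℝ)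
          ≤ C * ((b - a) * Real.sqrt (Real.log n) / ((n : ℝ) * σ * Δ) + 1 / n) := by
  refine ⟨1500000, by norm_num, ?_⟩
  intro n w v Δ σ hΔ hv hσ hσ0 a b hab
  have hn0 : 0 < n := by
    rcases Nat.eq_zero_or_pos n with h | h
    · subst h; simp at hσ; linarith
    · exact h
  have hn' : (0:ℝ) < n := by exact_mod_cast hn0
  have hfac : (0:ℝ) < n.factorial := by exact_mod_cast n.factorial_pos
  have hba : 0 ≤ b - a := by linarith
  rcases Nat.lt_or_ge n 3 with hn | hn
  · have h1 : ((Finset.univ.filter (fun π : Equiv.Perm (Fin n) =>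
            (∑ i, w (π i) * v i) ∈ Set.Icc a b)).card : ℝ) / (Nat.factorial n : ℝ) ≤ 1 := by
      rw [div_le_one hfac]
      have := Finset.card_filter_le (univ : Finset (Equiv.Perm (Fin n))) (fun π => (∑ i, w (π i) * v i) ∈ Set.Icc a b)
      rw [Finset.card_univ, Fintype.card_perm, Fintype.card_fin] at this
      exact_mod_cast this
    have h2 : 0 ≤ (b - a) * Real.sqrt (Real.log n) / ((n : ℝ) * σ * Δ) := by positivity
    have h3 : (1:ℝ) / 2 ≤ 1 / n := by
      apply one_div_le_one_div_of_le hn'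
      exact_mod_cast (by omega : n ≤ 2)
    linarith
  · have hσ2 : σ ^ 2 = ∑ i, (w i - (∑ j, w j) / n) ^ 2 := by
      rw [hσ, Real.sq_sqrt]
      exact Finset.sum_nonneg fun i _ => sq_nonneg _
    have hlog : 0 < Real.log n := Real.log_pos (by exact_mod_cast (by omega : 1 < n))
    have hsq : 0 < Real.sqrt (Real.log n) := Real.sqrt_pos.2 hlog
    have hc := conc hn w v Δ σ hΔ hv hσ0 hσ2
    set r := σ * Δ / (1000 * Real.sqrt (Real.log n)) with hr
    have hr0 : 0 < r := by positivity
    set K := ⌊(b - a) / (2 * r)⌋₊ + 1 with hK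
    have hsub : (Finset.univ.filter (fun π : Equiv.Perm (Fin n) => (∑ i, w (π i) * v i) ∈ Set.Icc a b)) ⊆
        (range K).biUnion (fun m => univ.filter (fun π : Equiv.Perm (Fin n) => |∑ i, w (π i) * v i - (a + (2 * m + 1) * r)| ≤ r)) := by
      intro π hπ
      have hx := (Finset.mem_filter.1 hπ).2
      simp only [mem_biUnion, mem_range, mem_filter, mem_univ, true_and]
      generalize ∑ i, w (π i) * v i = x at hx
      have hx0 : 0 ≤ (x - a) / (2 * r) := div_nonneg (by linarith [hx.1]) (by positivity)
      refine ⟨⌊(x - a) / (2 * r)⌋₊, ?_, ?_⟩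
      · rw [hK, Nat.lt_succ_iff]
        apply Nat.floor_mono
        gcongr
        exact hx.2
      · have f1 := Nat.floor_le hx0
        have f2 := Nat.lt_floor_add_one ((x - a) / (2 * r))
        rw [le_div_iff₀ (by positivity)] at f1
        rw [div_lt_iff₀ (by positivity)] at f2
        rw [abs_le]
        constructor <;> nlinarith
    have hcard : ((Finset.univ.filter (fun π : Equiv.Perm (Fin n) =>
            (∑ i, w (π i) * v i) ∈ Set.Icc a b)).card : ℝ) ≤ K * (3000 * (n.factorial / n)) := by
      calc _ ≤ ((∑ m ∈ range K, (univ.filter (fun π : Equiv.Perm (Fin n) => |∑ i, w (π i) * v i - (a + (2 * m + 1) * r)| ≤ r)).card : ℕ) : ℝ) := by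
            exact_mod_cast (Finset.card_le_card hsub).trans Finset.card_biUnion_le
        _ ≤ ∑ m ∈ range K, (3000 * ((n.factorial:ℝ) / n)) := by
            push_cast
            exact Finset.sum_le_sum fun m _ => hc _
        _ = _ := by simp
    have hKle : (K:ℝ) ≤ (b - a) / (2 * r) + 1 := by
      rw [hK]; push_cast
      have := Nat.floor_le (div_nonneg hba (by positivity : 0 ≤ 2 * r))
      linarith
    rw [div_le_iff₀ hfac]
    calc _ ≤ K * (3000 * ((n.factorial:ℝ) / n)) := hcard
      _ ≤ ((b - a) / (2 * r) + 1) * (3000 * ((n.factorial:ℝ) / n)) := by gcongr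
      _ = (1500000 * ((b - a) * Real.sqrt (Real.log n) / ((n : ℝ) * σ * Δ)) + 3000 * (1 / n)) * n.factorial := by
          rw [hr]; field_simp; ring
      _ ≤ _ := by
          have : (0:ℝ) < 1 / n := by positivity
          apply mul_le_mul_of_nonneg_right _ hfac.le
          linarith
end

section
/- Let v ∈ ℝ^n have all distinct coordinates and let w ∈ ℝ^n satisfy that not all coordinates of w are equal. If n is odd, then for every x ∈ ℝ, with π a uniformly random permutation, P(∑_i w_{π(i)} v_i = x) ≤ 1/n; if n is even, the bound is 1/(n−1). -/
open scoped Classical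
open Finset

namespace HopProof

def nx (m i : ℕ) : ℕ := if i + 1 = m then 0 else i + 1

lemma nx_lt {m i : ℕ} (h : i < m) : nx m i < m := by
  unfold nx; split_ifs <;> omega

structure Hop (Ω : Type) (m : ℕ) where
  a : Ω → ℕ → Bool
  tau : ℕ → Ω → Ω
  m3 : 3 ≤ m
  inv : ∀ i, i < m → ∀ ω, tau i (tau i ω) = ω
  a1 : ∀ i, i < m → ∀ ω, a (tau i ω) i = a ω (nx m i)
  a2 : ∀ i, i < m → ∀ ω, a (tau i ω) (nx m i) = a ω i
  a3 : ∀ i, i < m → ∀ k, k < m → k ≠ i → k ≠ nx m i → ∀ ω, a (tau i ω) k = a ω k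
  comm : ∀ i, i < m → ∀ j, j < m → i ≠ j → nx m i ≠ j → nx m j ≠ i →
    ∀ ω, tau i (tau j ω) = tau j (tau i ω)

variable {Ω : Type} [Fintype Ω] {m : ℕ} (P : Hop Ω m)

noncomputable def up (i : ℕ) : (Ω → ℝ) →ₗ[ℝ] (Ω → ℝ) where
  toFun f ω := if P.a ω i = false ∧ P.a ω (nx m i) = true then f (P.tau i ω) else 0
  map_add' f g := by ext ω; simp only [Pi.add_apply]; split_ifs <;> simp
  map_smul' c f := by ext ω; simp only [Pi.smul_apply, RingHom.id_apply]; split_ifs <;> simp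

noncomputable def dn (i : ℕ) : (Ω → ℝ) →ₗ[ℝ] (Ω → ℝ) where
  toFun f ω := if P.a ω i = true ∧ P.a ω (nx m i) = false then f (P.tau i ω) else 0
  map_add' f g := by ext ω; simp only [Pi.add_apply]; split_ifs <;> simp
  map_smul' c f := by ext ω; simp only [Pi.smul_apply, RingHom.id_apply]; split_ifs <;> simp

omit [Fintype Ω] in
lemma up_apply (i : ℕ) (f : Ω → ℝ) (ω : Ω) : up P i f ω =
  if P.a ω i = false ∧ P.a ω (nx m i) = true then f (P.tau i ω) else 0 := rfl
omit [Fintype Ω] in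
lemma dn_apply (i : ℕ) (f : Ω → ℝ) (ω : Ω) : dn P i f ω =
  if P.a ω i = true ∧ P.a ω (nx m i) = false then f (P.tau i ω) else 0 := rfl

noncomputable def Eop (c : ℕ → ℝ) : (Ω → ℝ) →ₗ[ℝ] (Ω → ℝ) := ∑ i ∈ range m, c i • up P i
noncomputable def Fop (c : ℕ → ℝ) : (Ω → ℝ) →ₗ[ℝ] (Ω → ℝ) := ∑ i ∈ range m, c i • dn P i

omit [Fintype Ω] in
lemma Eop_apply (c : ℕ → ℝ) (f : Ω → ℝ) (ω : Ω) :
    Eop P c f ω = ∑ i ∈ range m, c i * up P i f ω := by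
  simp [Eop]
omit [Fintype Ω] in
lemma Fop_apply (c : ℕ → ℝ) (f : Ω → ℝ) (ω : Ω) :
    Fop P c f ω = ∑ i ∈ range m, c i * dn P i f ω := by
  simp [Fop]

lemma adj1 {i : ℕ} (hi : i < m) (f g : Ω → ℝ) :
    ∑ ω, up P i f ω * g ω = ∑ ω, f ω * dn P i g ω := by
  have hinv : Function.Involutive (P.tau i) := P.inv i hi
  rw [← Equiv.sum_comp hinv.toPerm (fun ω => up P i f ω * g ω)]
  apply Finset.sum_congr rfl
  intro ω _
  simp only [Function.Involutive.coe_toPerm, up_apply, dn_apply, P.inv i hi, P.a1 i hi, P.a2 i hi]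
  by_cases h1 : P.a ω i = true <;> by_cases h2 : P.a ω (nx m i) = true <;> simp [h1, h2]

lemma adjE (c : ℕ → ℝ) (f g : Ω → ℝ) :
    ∑ ω, Eop P c f ω * g ω = ∑ ω, f ω * Fop P c g ω := by
  simp only [Eop_apply, Fop_apply, Finset.sum_mul, Finset.mul_sum]
  rw [Finset.sum_comm, Finset.sum_comm (s := univ)]
  apply Finset.sum_congr rfl
  intro i hi
  have := adj1 P (Finset.mem_range.1 hi) f g
  calc _ = c i * ∑ ω, up P i f ω * g ω := by
        rw [Finset.mul_sum]; apply Finset.sum_congr rfl; intros; ring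
    _ = _ := by
        rw [this, Finset.mul_sum]; apply Finset.sum_congr rfl; intros; ring

def nn (b : Bool) : ℝ := if b then 1 else 0

omit [Fintype Ω] in
lemma comm_ne {i j : ℕ} (hi : i < m) (hj : j < m) (hij : i ≠ j) (f : Ω → ℝ) (ω : Ω) :
    up P i (dn P j f) ω = dn P j (up P i f) ω := by
  simp only [up_apply, dn_apply]
  have hm := P.m3
  have hii : nx m i ≠ i := by unfold nx; split_ifs <;> omega
  have hjj : nx m j ≠ j := by unfold nx; split_ifs <;> omega
  have hnij : nx m i ≠ nx m j := by unfold nx; split_ifs <;> omega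
  have hli := nx_lt hi
  have hlj := nx_lt hj
  by_cases h1 : nx m i = j
  · have h2 : nx m j ≠ i := by rw [← h1]; unfold nx; split_ifs <;> omega
    have e1 := P.a2 i hi ω
    have e2 := P.a1 j hj ω
    rw [h1] at e1 ⊢
    rw [e1, e2]
    by_cases x1 : P.a ω i = true <;> by_cases x2 : P.a ω j = true <;>
      by_cases x3 : P.a ω (nx m j) = true <;> simp_all
  · by_cases h2 : nx m j = i
    · have e1 := P.a1 i hi ω
      have e2 := P.a2 j hj ω
      rw [h2] at e2 ⊢
      rw [e1, e2]
      by_cases x1 : P.a ω i = true <;> by_cases x2 : P.a ω j = true <;>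
        by_cases x3 : P.a ω (nx m i) = true <;> simp_all
    · rw [P.a3 i hi j hj (Ne.symm hij) (Ne.symm h1) ω,
        P.a3 i hi (nx m j) hlj h2 (Ne.symm hnij) ω,
        P.a3 j hj i hi hij (Ne.symm h2) ω,
        P.a3 j hj (nx m i) hli h1 hnij ω, P.comm i hi j hj hij h1 h2 ω]
      split_ifs <;> rfl

omit [Fintype Ω] in
lemma comm_eq {i : ℕ} (hi : i < m) (f : Ω → ℝ) (ω : Ω) :
    up P i (dn P i f) ω = dn P i (up P i f) ω + (nn (P.a ω (nx m i)) - nn (P.a ω i)) * f ω := by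
  simp only [up_apply, dn_apply, P.inv i hi, P.a1 i hi, P.a2 i hi, nn]
  by_cases h1 : P.a ω i = true <;> by_cases h2 : P.a ω (nx m i) = true <;> simp [h1, h2]

noncomputable def HH (c : ℕ → ℝ) (ω : Ω) : ℝ :=
  ∑ i ∈ range m, c i ^ 2 * (nn (P.a ω (nx m i)) - nn (P.a ω i))

omit [Fintype Ω] in
lemma EF (c : ℕ → ℝ) (f : Ω → ℝ) (ω : Ω) :
    Eop P c (Fop P c f) ω = Fop P c (Eop P c f) ω + HH P c ω * f ω := by
  have h1 : Eop P c (Fop P c f) ω =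
      ∑ i ∈ range m, ∑ j ∈ range m, c i * c j * up P i (dn P j f) ω := by
    simp only [Eop_apply, Fop, LinearMap.sum_apply, map_sum, Finset.sum_apply, Finset.mul_sum,
      LinearMap.smul_apply, map_smul, Pi.smul_apply, smul_eq_mul]
    refine Finset.sum_congr rfl fun i _ => Finset.sum_congr rfl fun j _ => by ring
  have h2 : Fop P c (Eop P c f) ω =
      ∑ i ∈ range m, ∑ j ∈ range m, c i * c j * dn P j (up P i f) ω := by
    rw [Finset.sum_comm]
    simp only [Fop_apply, Eop, LinearMap.sum_apply, map_sum, Finset.sum_apply, Finset.mul_sum,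
      LinearMap.smul_apply, map_smul, Pi.smul_apply, smul_eq_mul]
    refine Finset.sum_congr rfl fun i _ => Finset.sum_congr rfl fun j _ => by ring
  rw [h1, h2, HH, Finset.sum_mul, ← Finset.sum_add_distrib]
  refine Finset.sum_congr rfl fun i hi => ?_
  have hi' := Finset.mem_range.1 hi
  rw [← Finset.add_sum_erase _ _ hi, ← Finset.add_sum_erase (range m) (fun j => c i * c j * dn P j (up P i f) ω) hi,
    comm_eq P hi']
  have : ∑ x ∈ (range m).erase i, c i * c x * (up P i) ((dn P x) f) ω =
      ∑ x ∈ (range m).erase i, c i * c x * (dn P x) ((up P i) f) ω := by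
    refine Finset.sum_congr rfl fun j hj => ?_
    rw [Finset.mem_erase, Finset.mem_range] at hj
    rw [comm_ne P hi' hj.2 (Ne.symm hj.1)]
  rw [this]; ring

lemma norm_id (c : ℕ → ℝ) (f : Ω → ℝ) :
    ∑ ω, Fop P c f ω ^ 2 = ∑ ω, Eop P c f ω ^ 2 + ∑ ω, HH P c ω * f ω ^ 2 := by
  have h1 : ∑ ω, Fop P c f ω ^ 2 = ∑ ω, f ω * Eop P c (Fop P c f) ω := by
    have := adjE P c (Fop P c f) f
    calc _ = ∑ ω, Fop P c f ω * Fop P c f ω := by simp [sq]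
      _ = _ := by rw [← this]; refine Finset.sum_congr rfl fun _ _ => by ring
  have h2 : ∑ ω, Eop P c f ω ^ 2 = ∑ ω, f ω * Fop P c (Eop P c f) ω := by
    rw [← adjE]; simp [sq]
  rw [h1, h2, ← Finset.sum_add_distrib]
  refine Finset.sum_congr rfl fun ω _ => ?_
  rw [EF]; ring

omit [Fintype Ω] in
lemma sum_nx (h : 0 < m) (g : ℕ → ℝ) : ∑ i ∈ range m, g (nx m i) = ∑ i ∈ range m, g i := by
  obtain ⟨M, rfl⟩ : ∃ M, m = M + 1 := ⟨m - 1, by omega⟩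
  rw [Finset.sum_range_succ, Finset.sum_range_succ' (fun i => g i)]
  congr 1
  · refine Finset.sum_congr rfl fun i hi => ?_
    rw [Finset.mem_range] at hi
    unfold nx; rw [if_neg (by omega)]
  · simp [nx]

omit [Fintype Ω] in
lemma HH_ring (ω : Ω) : HH P (fun _ => 1) ω = 0 := by
  have := P.m3
  simp only [HH, one_pow, one_mul, Finset.sum_sub_distrib]
  rw [sum_nx (by omega) (fun i => nn (P.a ω i))]; simp

def Hi (ω : Ω) : ℤ := ∑ i ∈ range m, if P.a ω i then (2 * i + 1 - m : ℤ) else 0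

noncomputable def cc (m i : ℕ) : ℝ := Real.sqrt ((i + 1 : ℝ) * (m - 1 - i))

lemma cc_sq {i : ℕ} (h : i < m) : cc m i ^ 2 = (i + 1 : ℝ) * (m - 1 - i) := by
  unfold cc
  apply Real.sq_sqrt
  have : (i : ℝ) + 1 ≤ m := by exact_mod_cast h
  apply mul_nonneg <;> [positivity; linarith]

omit [Fintype Ω] in
lemma HH_cc (ω : Ω) : HH P (cc m) ω = Hi P ω := by
  have hm := P.m3
  have h1 : HH P (cc m) ω = ∑ i ∈ range m, ((i + 1 : ℝ) * (m - 1 - i)) * nn (P.a ω (nx m i))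
      - ∑ i ∈ range m, ((i + 1 : ℝ) * (m - 1 - i)) * nn (P.a ω i) := by
    rw [HH, ← Finset.sum_sub_distrib]
    refine Finset.sum_congr rfl fun i hi => ?_
    rw [cc_sq (Finset.mem_range.1 hi)]; ring
  have h2 : ∑ i ∈ range m, ((i + 1 : ℝ) * (m - 1 - i)) * nn (P.a ω (nx m i)) =
      ∑ i ∈ range m, ((i : ℝ) * (m - i)) * nn (P.a ω i) := by
    rw [← sum_nx (by omega) (fun i => ((i : ℝ) * (m - i)) * nn (P.a ω i))]
    refine Finset.sum_congr rfl fun i hi => ?_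
    congr 1
    unfold nx
    split_ifs with h
    · rw [← h]; push_cast; ring
    · push_cast; ring
  rw [h1, h2, Hi, ← Finset.sum_sub_distrib]
  push_cast
  refine Finset.sum_congr rfl fun i hi => ?_
  unfold nn; split_ifs <;> push_cast <;> ring

omit [Fintype Ω] in
lemma Hi_tau {i : ℕ} (hi : i < m) (ω : Ω) (h1 : P.a ω i = true) (h2 : P.a ω (nx m i) = false) :
    Hi P (P.tau i ω) = Hi P ω + 2 * (nx m i : ℤ) - 2 * i := by
  have hm := P.m3
  have hii : nx m i ≠ i := by unfold nx; split_ifs <;> omega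
  have hl := nx_lt hi
  have hs : ({i, nx m i} : Finset ℕ) ⊆ range m := by
    intro k hk; simp at hk ⊢; omega
  have : Hi P (P.tau i ω) - Hi P ω = 2 * (nx m i : ℤ) - 2 * i := by
    unfold Hi
    rw [← Finset.sum_sub_distrib, ← Finset.sum_subset hs]
    · rw [Finset.sum_pair (Ne.symm hii), P.a1 i hi, P.a2 i hi, h1, h2]; simp
    · intro k hk hk'
      simp at hk hk'
      rw [P.a3 i hi k hk hk'.1 hk'.2]; simp
  linarith

def q (ω : Ω) : ℤ := Hi P ω / 2

omit [Fintype Ω] in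
lemma q_up {i : ℕ} (hi : i < m) (ω : Ω) (h1 : P.a ω i = false) (h2 : P.a ω (nx m i) = true) :
    q P (P.tau i ω) = q P ω - nx m i + i := by
  have := Hi_tau P hi (P.tau i ω) (by rw [P.a1 i hi, h2]) (by rw [P.a2 i hi, h1])
  rw [P.inv i hi] at this
  unfold q; omega

omit [Fintype Ω] in
lemma q_dn {i : ℕ} (hi : i < m) (ω : Ω) (h1 : P.a ω i = true) (h2 : P.a ω (nx m i) = false) :
    q P (P.tau i ω) = q P ω + nx m i - i := by
  have := Hi_tau P hi ω h1 h2
  unfold q; omega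

lemma card_le (L : (Ω → ℝ) →ₗ[ℝ] (Ω → ℝ)) (A B : Ω → Prop)
    [DecidablePred A] [DecidablePred B]
    (h1 : ∀ f : Ω → ℝ, (∀ ω, ¬ A ω → f ω = 0) → ∀ ω, ¬ B ω → L f ω = 0)
    (h2 : ∀ f : Ω → ℝ, (∀ ω, ¬ A ω → f ω = 0) → L f = 0 → f = 0) :
    (univ.filter A).card ≤ (univ.filter B).card := by
  let ext : ({ω // A ω} → ℝ) →ₗ[ℝ] (Ω → ℝ) :=
    { toFun := fun f ω => if h : A ω then f ⟨ω, h⟩ else 0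
      map_add' := by intro f g; ext ω; simp only [Pi.add_apply]; split_ifs <;> simp
      map_smul' := by
        intro c f; ext ω; simp only [Pi.smul_apply, RingHom.id_apply]; split_ifs <;> simp }
  let res : (Ω → ℝ) →ₗ[ℝ] ({ω // B ω} → ℝ) := LinearMap.funLeft ℝ ℝ Subtype.val
  have hext : ∀ f ω, ¬ A ω → ext f ω = 0 := by
    intro f ω h; change (if h : A ω then f ⟨ω, h⟩ else 0) = 0; simp [h]
  have hinj : Function.Injective (res ∘ₗ L ∘ₗ ext) := by
    rw [← LinearMap.ker_eq_bot, LinearMap.ker_eq_bot']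
    intro f hf
    have h3 : L (ext f) = 0 := by
      ext ω
      by_cases hB : B ω
      · exact congrFun hf ⟨ω, hB⟩
      · exact h1 _ (hext f) ω hB
    have h4 := h2 _ (hext f) h3
    ext ⟨ω, hω⟩
    have := congrFun h4 ω
    change (if h : A ω then f ⟨ω, h⟩ else 0) = 0 at this
    simpa [hω] using this
  have := LinearMap.finrank_le_finrank_of_injective hinj
  simpa [Fintype.card_subtype] using this


section push
variable (s : Ω → ℝ)
  (hs : ∀ i, i + 1 < m → ∀ ω, P.a ω i = true → P.a ω (i + 1) = false → s ω < s (P.tau i ω))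
include hs

lemma push_up (x : ℝ) (r : ℤ) (hr : r < 0) :
    (univ.filter (fun ω => q P ω = r ∧ x ≤ s ω)).card ≤
    (univ.filter (fun ω => q P ω = r + 1 ∧ x < s ω)).card := by
  apply card_le (Eop P (cc m))
  · intro f hf ω hω
    rw [Eop_apply]
    refine Finset.sum_eq_zero fun i hi => ?_
    rw [Finset.mem_range] at hi
    by_cases him : i + 1 = m
    · have : cc m i = 0 := by
        unfold cc; rw [← him]; push_cast; simp
      rw [this, zero_mul]
    · rw [up_apply]
      have hn : nx m i = i + 1 := by unfold nx; rw [if_neg him]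
      split_ifs with h
      · rw [hf, mul_zero]
        rintro ⟨h3, h4⟩
        apply hω
        have h5 := q_up P hi ω h.1 h.2
        have h6 := hs i (by omega) (P.tau i ω) (by rw [P.a1 i hi, h.2])
          (by rw [← hn, P.a2 i hi, h.1])
        rw [P.inv i hi] at h6
        rw [hn] at h5
        push_cast at h5
        exact ⟨by linarith, by linarith⟩
      · simp
  · intro f hf h0
    have h := norm_id P (cc m) f
    simp only [h0, HH_cc, Pi.zero_apply] at h
    have hneg : ∀ ω, (Hi P ω : ℝ) * f ω ^ 2 ≤ 0 := by
      intro ω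
      by_cases hA : q P ω = r ∧ x ≤ s ω
      · have : Hi P ω < 0 := by have := hA.1; unfold q at this; omega
        have : (Hi P ω : ℝ) < 0 := by exact_mod_cast this
        nlinarith [sq_nonneg (f ω)]
      · rw [hf ω hA]; simp
    have hsum : ∑ ω, (Hi P ω : ℝ) * f ω ^ 2 = 0 := by
      apply le_antisymm (Finset.sum_nonpos fun ω _ => hneg ω)
      have : 0 ≤ ∑ ω, Fop P (cc m) f ω ^ 2 := Finset.sum_nonneg fun _ _ => sq_nonneg _
      simpa [h] using this
    rw [Finset.sum_eq_zero_iff_of_nonpos fun ω _ => hneg ω] at hsum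
    ext ω
    by_cases hA : q P ω = r ∧ x ≤ s ω
    · have h1 : Hi P ω < 0 := by have := hA.1; unfold q at this; omega
      have h2 : (Hi P ω : ℝ) ≠ 0 := by exact_mod_cast h1.ne
      have := hsum ω (mem_univ _)
      simpa [h2] using this
    · exact hf ω hA

lemma push_dn (x : ℝ) (r : ℤ) (hr : 0 < r) :
    (univ.filter (fun ω => q P ω = r ∧ s ω ≤ x)).card ≤
    (univ.filter (fun ω => q P ω = r - 1 ∧ s ω < x)).card := by
  apply card_le (Fop P (cc m))
  · intro f hf ω hω
    rw [Fop_apply]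
    refine Finset.sum_eq_zero fun i hi => ?_
    rw [Finset.mem_range] at hi
    by_cases him : i + 1 = m
    · have : cc m i = 0 := by
        unfold cc; rw [← him]; push_cast; simp
      rw [this, zero_mul]
    · rw [dn_apply]
      have hn : nx m i = i + 1 := by unfold nx; rw [if_neg him]
      split_ifs with h
      · rw [hf, mul_zero]
        rintro ⟨h3, h4⟩
        apply hω
        have h5 := q_dn P hi ω h.1 h.2
        have h6 := hs i (by omega) ω h.1 (by rw [← hn, h.2])
        rw [hn] at h5
        push_cast at h5
        exact ⟨by linarith, by linarith⟩
      · simp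
  · intro f hf h0
    have h := norm_id P (cc m) f
    simp only [h0, HH_cc, Pi.zero_apply] at h
    have hneg : ∀ ω, 0 ≤ (Hi P ω : ℝ) * f ω ^ 2 := by
      intro ω
      by_cases hA : q P ω = r ∧ s ω ≤ x
      · have : 0 < Hi P ω := by have := hA.1; unfold q at this; omega
        have : 0 < (Hi P ω : ℝ) := by exact_mod_cast this
        positivity
      · rw [hf ω hA]; simp
    have hsum : ∑ ω, (Hi P ω : ℝ) * f ω ^ 2 = 0 := by
      apply le_antisymm _ (Finset.sum_nonneg fun ω _ => hneg ω)
      have : 0 ≤ ∑ ω, Eop P (cc m) f ω ^ 2 := Finset.sum_nonneg fun _ _ => sq_nonneg _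
      simp at h
      linarith
    rw [Finset.sum_eq_zero_iff_of_nonneg fun ω _ => hneg ω] at hsum
    ext ω
    by_cases hA : q P ω = r ∧ s ω ≤ x
    · have h1 : 0 < Hi P ω := by have := hA.1; unfold q at this; omega
      have h2 : (Hi P ω : ℝ) ≠ 0 := by exact_mod_cast h1.ne'
      have := hsum ω (mem_univ _)
      simpa [h2] using this
    · exact hf ω hA

lemma tele_up (x : ℝ) :
    (univ.filter (fun ω => q P ω < 0 ∧ s ω = x)).card ≤
    (univ.filter (fun ω => q P ω = 0 ∧ x < s ω)).card := by
  obtain ⟨N, hN⟩ : ∃ N : ℕ, ∀ ω, -(N : ℤ) ≤ q P ω := by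
    refine ⟨∑ ω, (q P ω).natAbs, fun ω => ?_⟩
    have := Finset.single_le_sum (f := fun ω => (q P ω).natAbs) (fun _ _ => Nat.zero_le _) (mem_univ ω)
    omega
  have key : ∀ j : ℕ, j ≤ N → (univ.filter (fun ω => q P ω < -(N : ℤ) + j ∧ s ω = x)).card ≤
      (univ.filter (fun ω => q P ω = -(N : ℤ) + j ∧ x < s ω)).card := by
    intro j
    induction j with
    | zero =>
      intro _
      rw [Finset.filter_false_of_mem]
      · simp
      · intro ω _ h; have := hN ω; have := h.1; omega
    | succ j ih =>
      intro hj
      have ih := ih (by omega)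
      have hp := push_up P s hs x (-(N : ℤ) + j) (by omega)
      have e1 : (univ.filter (fun ω => q P ω = -(N : ℤ) + j ∧ x ≤ s ω)).card =
          (univ.filter (fun ω => q P ω = -(N : ℤ) + j ∧ x < s ω)).card +
          (univ.filter (fun ω => q P ω = -(N : ℤ) + j ∧ s ω = x)).card := by
        rw [← Finset.card_union_of_disjoint]
        · congr 1; ext ω; simp only [mem_filter, mem_univ, true_and, mem_union]
          rw [le_iff_lt_or_eq, eq_comm (a := x)]; tauto
        · rw [Finset.disjoint_filter]; rintro ω _ ⟨_, h1⟩ ⟨_, h2⟩; exact h1.ne' h2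
      have e2 : (univ.filter (fun ω => q P ω < -(N : ℤ) + (j + 1 : ℕ) ∧ s ω = x)).card =
          (univ.filter (fun ω => q P ω < -(N : ℤ) + j ∧ s ω = x)).card +
          (univ.filter (fun ω => q P ω = -(N : ℤ) + j ∧ s ω = x)).card := by
        rw [← Finset.card_union_of_disjoint]
        · congr 1; ext ω; simp only [mem_filter, mem_univ, true_and, mem_union]
          rw [← or_and_right]
          refine and_congr_left fun _ => ?_
          push_cast; omega
        · rw [Finset.disjoint_filter]; rintro ω _ ⟨h1, _⟩ ⟨h2, _⟩; omega
      have e3 : (-(N : ℤ) + (j + 1 : ℕ)) = -(N : ℤ) + j + 1 := by push_cast; ring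
      rw [e2, e3]; omega
  have := key N le_rfl
  simpa using this

lemma tele_dn (x : ℝ) :
    (univ.filter (fun ω => 0 < q P ω ∧ s ω = x)).card ≤
    (univ.filter (fun ω => q P ω = 0 ∧ s ω < x)).card := by
  obtain ⟨N, hN⟩ : ∃ N : ℕ, ∀ ω, q P ω ≤ N := by
    refine ⟨∑ ω, (q P ω).natAbs, fun ω => ?_⟩
    have := Finset.single_le_sum (f := fun ω => (q P ω).natAbs) (fun _ _ => Nat.zero_le _) (mem_univ ω)
    omega
  have key : ∀ j : ℕ, j ≤ N → (univ.filter (fun ω => (N : ℤ) - j < q P ω ∧ s ω = x)).card ≤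
      (univ.filter (fun ω => q P ω = (N : ℤ) - j ∧ s ω < x)).card := by
    intro j
    induction j with
    | zero =>
      intro _
      rw [Finset.filter_false_of_mem]
      · simp
      · intro ω _ h; have := hN ω; have := h.1; omega
    | succ j ih =>
      intro hj
      have ih := ih (by omega)
      have hp := push_dn P s hs x ((N : ℤ) - j) (by omega)
      have e1 : (univ.filter (fun ω => q P ω = (N : ℤ) - j ∧ s ω ≤ x)).card =
          (univ.filter (fun ω => q P ω = (N : ℤ) - j ∧ s ω < x)).card +
          (univ.filter (fun ω => q P ω = (N : ℤ) - j ∧ s ω = x)).card := by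
        rw [← Finset.card_union_of_disjoint]
        · congr 1; ext ω; simp only [mem_filter, mem_univ, true_and, mem_union]
          rw [le_iff_lt_or_eq]; tauto
        · rw [Finset.disjoint_filter]; rintro ω _ ⟨_, h1⟩ ⟨_, h2⟩; exact h1.ne h2
      have e2 : (univ.filter (fun ω => (N : ℤ) - (j + 1 : ℕ) < q P ω ∧ s ω = x)).card =
          (univ.filter (fun ω => (N : ℤ) - j < q P ω ∧ s ω = x)).card +
          (univ.filter (fun ω => q P ω = (N : ℤ) - j ∧ s ω = x)).card := by
        rw [← Finset.card_union_of_disjoint]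
        · congr 1; ext ω; simp only [mem_filter, mem_univ, true_and, mem_union]
          rw [← or_and_right]
          refine and_congr_left fun _ => ?_
          push_cast; omega
        · rw [Finset.disjoint_filter]; rintro ω _ ⟨h1, _⟩ ⟨h2, _⟩; omega
      have e3 : ((N : ℤ) - (j + 1 : ℕ)) = (N : ℤ) - j - 1 := by push_cast; ring
      rw [e2, e3]; omega
  have := key N le_rfl
  simpa using this

lemma sperner (x : ℝ) :
    (univ.filter (fun ω => s ω = x)).card ≤ (univ.filter (fun ω => q P ω = 0)).card := by
  have h1 := tele_up P s hs x
  have h2 := tele_dn P s hs x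
  have e1 : (univ.filter (fun ω => s ω = x)).card ≤
      (univ.filter (fun ω => q P ω < 0 ∧ s ω = x)).card +
      (univ.filter (fun ω => q P ω = 0 ∧ s ω = x)).card +
      (univ.filter (fun ω => 0 < q P ω ∧ s ω = x)).card := by
    refine le_trans (Finset.card_le_card (t := (univ.filter (fun ω => q P ω < 0 ∧ s ω = x) ∪
      univ.filter (fun ω => q P ω = 0 ∧ s ω = x)) ∪ univ.filter (fun ω => 0 < q P ω ∧ s ω = x)) ?_) ?_
    · intro ω hω
      simp only [mem_filter, mem_univ, true_and, mem_union] at hω ⊢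
      rcases lt_trichotomy (q P ω) 0 with h | h | h <;> simp [h, hω]
    · refine (Finset.card_union_le _ _).trans ?_
      gcongr
      exact Finset.card_union_le _ _
  have e2 : (univ.filter (fun ω => q P ω = 0)).card =
      (univ.filter (fun ω => q P ω = 0 ∧ x < s ω)).card +
      (univ.filter (fun ω => q P ω = 0 ∧ s ω = x)).card +
      (univ.filter (fun ω => q P ω = 0 ∧ s ω < x)).card := by
    rw [← Finset.card_union_of_disjoint, ← Finset.card_union_of_disjoint]
    · congr 1; ext ω; simp only [mem_filter, mem_univ, true_and, mem_union]
      rcases lt_trichotomy (s ω) x with h | h | h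
      · simp [h]; tauto
      · simp [h]
      · simp [h]; tauto
    · rw [Finset.disjoint_left]; intro ω h3 h4
      simp only [mem_filter, mem_univ, true_and, mem_union] at h3 h4
      rcases h3 with h3 | h3 <;> linarith [h3.2, h4.2]
    · rw [Finset.disjoint_filter]; rintro ω _ ⟨_, h1⟩ ⟨_, h2⟩; exact h1.ne' h2
  omega
end push

lemma F_of_E (f : Ω → ℝ) (h : Eop P (fun _ => 1) f = 0) : Fop P (fun _ => 1) f = 0 := by
  have := norm_id P (fun _ => 1) f
  simp only [h, HH_ring, Pi.zero_apply] at this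
  simp at this
  rw [Finset.sum_eq_zero_iff_of_nonneg fun ω _ => sq_nonneg _] at this
  ext ω
  simpa using this ω (mem_univ _)

lemma pow_ker (t : ℕ) (f : Ω → ℝ) (h : (Eop P (fun _ => 1) ^ (t + 1)) f = 0) :
    Eop P (fun _ => 1) f = 0 := by
  induction t with
  | zero => simpa using h
  | succ t ih =>
    apply ih
    rw [pow_succ', Module.End.mul_apply] at h
    have h1 := F_of_E P _ h
    have h2 := adjE P (fun _ => 1) ((Eop P (fun _ => 1) ^ t) f) ((Eop P (fun _ => 1) ^ (t + 1)) f)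
    rw [h1] at h2
    rw [← Module.End.mul_apply, ← pow_succ'] at h2
    simp at h2
    rw [Finset.sum_eq_zero_iff_of_nonneg fun ω _ => mul_self_nonneg _] at h2
    ext ω
    simpa using h2 ω (mem_univ _)

lemma ring_card (hker : ∀ f : Ω → ℝ, (∀ ω, q P ω ≠ 0 → f ω = 0) →
      Eop P (fun _ => 1) f = 0 → f = 0) :
    m * (univ.filter (fun ω => q P ω = 0)).card ≤ Fintype.card Ω := by
  have hm := P.m3
  have h1 : ∀ t : ℕ, (univ.filter (fun ω => q P ω = 0)).card ≤
      (univ.filter (fun ω => (m : ℤ) ∣ q P ω - t)).card := by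
    intro t
    apply card_le (Eop P (fun _ => 1) ^ t)
    · intro f hf
      induction t with
      | zero => intro ω hω; apply hf; intro h; apply hω; simp [h]
      | succ t ih =>
        intro ω hω
        rw [pow_succ', Module.End.mul_apply, Eop_apply]
        refine Finset.sum_eq_zero fun i hi => ?_
        rw [Finset.mem_range] at hi
        rw [up_apply]
        split_ifs with h
        · rw [ih, mul_zero]
          intro hd
          apply hω
          rw [q_up P hi ω h.1 h.2] at hd
          obtain ⟨z, hz⟩ := hd
          unfold nx at hz
          split_ifs at hz with h3
          · refine ⟨z - 1, ?_⟩
            push_cast at hz ⊢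
            have : (m : ℤ) = i + 1 := by exact_mod_cast h3.symm
            rw [mul_sub]; linarith
          · refine ⟨z, ?_⟩
            push_cast at hz ⊢; linarith
        · simp
    · intro f hf h0
      cases t with
      | zero => simpa using h0
      | succ t => exact hker f hf (pow_ker P t f h0)
  have h2 : ∑ t ∈ range m, (univ.filter (fun ω => (m : ℤ) ∣ q P ω - t)).card ≤ Fintype.card Ω := by
    rw [← Finset.card_biUnion]
    · exact Finset.card_le_univ _
    · intro t ht t' ht' hne
      simp only [Finset.coe_range, Set.mem_Iio] at ht ht'
      change Disjoint (univ.filter (fun ω => (m : ℤ) ∣ q P ω - t)) (univ.filter (fun ω => (m : ℤ) ∣ q P ω - t'))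
      rw [Finset.disjoint_filter]
      intro ω _ h3 h4
      have h5 := dvd_sub h3 h4
      have h6 : (q P ω - t - (q P ω - t')) = (t' : ℤ) - t := by ring
      rw [h6] at h5
      have := Int.eq_zero_of_abs_lt_dvd h5 (by rw [abs_lt]; constructor <;> omega)
      omega
  calc _ = ∑ t ∈ range m, (univ.filter (fun ω => q P ω = 0)).card := by simp
    _ ≤ _ := Finset.sum_le_sum fun t _ => h1 t
    _ ≤ _ := h2

def dual : Hop Ω m where
  a ω i := !(P.a ω i)
  tau := P.tau
  m3 := P.m3
  inv := P.inv
  a1 i hi ω := by rw [P.a1 i hi]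
  a2 i hi ω := by rw [P.a2 i hi]
  a3 i hi k hk h1 h2 ω := by rw [P.a3 i hi k hk h1 h2]
  comm := P.comm

omit [Fintype Ω] in
lemma dual_up (i : ℕ) (f : Ω → ℝ) (ω : Ω) : up (dual P) i f ω = dn P i f ω := by
  simp [up_apply, dn_apply, dual]

omit [Fintype Ω] in
lemma two_term (f : Ω → ℝ) (hX : ∀ ω, ∑ i ∈ range m, up P i f ω = 0) (j l : ℕ)
    (hl : j + l + 1 = m) (hj : j + 1 < l) (hsym : ∀ ω, f ω ≠ 0 → P.a ω j = P.a ω l)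
    (B : Ω) (h1 : P.a B j = false) (h2 : P.a B l = true) :
    up P (l - 1) f B + up P j f B = 0 := by
  have hs : ({l - 1, j} : Finset ℕ) ⊆ range m := by
    intro k hk; simp at hk ⊢; omega
  rw [← Finset.sum_pair (f := fun i => up P i f B) (by omega : l - 1 ≠ j), Finset.sum_subset hs, hX B]
  intro i hi hi'
  simp at hi hi'
  rw [up_apply]
  split_ifs with h
  · by_contra hne
    have h3 := hsym _ hne
    have e1 : P.a (P.tau i B) j = P.a B j := by
      apply P.a3 i hi j (by omega) (by omega)
      rintro h4; rw [← h4] at h; simp [h1] at h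
    have e2 : P.a (P.tau i B) l = P.a B l := by
      apply P.a3 i hi l (by omega)
      · rintro h4; rw [← h4] at h; simp [h2] at h
      · unfold nx; split_ifs <;> omega
    rw [e1, e2, h1, h2] at h3
    simp at h3
  · rfl

omit [Fintype Ω] in
lemma step (f : Ω → ℝ) (hX : ∀ ω, ∑ i ∈ range m, up P i f ω = 0) (j l : ℕ)
    (hl : j + l + 1 = m) (hj : j + 1 < l) (hsym : ∀ ω, f ω ≠ 0 → P.a ω j = P.a ω l)
    (ω : Ω) (hω : f ω ≠ 0) :
    (P.a ω j = false → P.a ω (l - 1) = true → P.a ω (j + 1) = true) ∧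
    (P.a ω j = true → P.a ω (j + 1) = false →
      l - 1 ≠ j + 1 ∧ P.a ω (l - 1) = false ∧ f (P.tau (l - 1) (P.tau j ω)) ≠ 0) := by
  have hnj : nx m j = j + 1 := by unfold nx; rw [if_neg (by omega)]
  have hnl : nx m (l - 1) = l := by unfold nx; rw [if_neg (by omega)]; omega
  have hjm : j < m := by omega
  have hlm : l - 1 < m := by omega
  have hs := hsym ω hω
  constructor
  · intro h1 h2
    have b1 : P.a (P.tau (l - 1) ω) j = false := by
      rw [P.a3 (l - 1) hlm j hjm (by omega) (by omega), h1]
    have b2 : P.a (P.tau (l - 1) ω) l = true := by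
      have := P.a2 (l - 1) hlm ω
      rw [hnl] at this; rw [this, h2]
    have b3 : P.a (P.tau (l - 1) ω) (l - 1) = false := by
      rw [P.a1 (l - 1) hlm, hnl, ← hs, h1]
    have h3 := two_term P f hX j l hl hj hsym _ b1 b2
    rw [up_apply, up_apply, hnl, hnj, if_pos ⟨b3, b2⟩, P.inv _ hlm] at h3
    split_ifs at h3 with h4
    · by_cases h5 : j + 1 = l - 1
      · rw [h5, h2]
      · rw [P.a3 (l - 1) hlm (j + 1) (by omega) h5 (by omega)] at h4
        exact h4.2
    · exfalso; apply hω; linarith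
  · intro h1 h2
    have b1 : P.a (P.tau j ω) j = false := by
      rw [P.a1 j hjm, hnj, h2]
    have b2 : P.a (P.tau j ω) l = true := by
      rw [P.a3 j hjm l (by omega) (by omega) (by omega), ← hs, h1]
    have b3 : P.a (P.tau j ω) (j + 1) = true := by
      have := P.a2 j hjm ω
      rw [hnj] at this; rw [this, h1]
    have h3 := two_term P f hX j l hl hj hsym _ b1 b2
    rw [up_apply, up_apply, hnl, hnj, if_pos (c := _ ∧ P.a (P.tau j ω) (j + 1) = true) ⟨b1, b3⟩, P.inv _ hjm] at h3
    split_ifs at h3 with h4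
    · have h5 : l - 1 ≠ j + 1 := by
        intro h5; rw [h5, b3] at h4; simp at h4
      refine ⟨h5, ?_, ?_⟩
      · rw [P.a3 j hjm (l - 1) (by omega) (by omega) (by omega)] at h4
        exact h4.1
      · intro h6; apply hω; linarith
    · exfalso; apply hω; linarith

lemma kernel (hgood : ∀ ω, (Odd m ∧ ∃ i < m, ∃ j < m, P.a ω i ≠ P.a ω j) ∨
      (Even m ∧ Odd ((range m).filter (fun i => P.a ω i = true)).card))
    (f : Ω → ℝ) (hf : ∀ ω, q P ω ≠ 0 → f ω = 0) (h0 : Eop P (fun _ => 1) f = 0) : f = 0 := by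
  have hm := P.m3
  have h0' := F_of_E P f h0
  have hX : ∀ ω, ∑ i ∈ range m, up P i f ω = 0 := by
    intro ω; have := congrFun h0 ω; rw [Eop_apply] at this; simpa using this
  have hY' : ∀ ω, ∑ i ∈ range m, dn P i f ω = 0 := by
    intro ω; have := congrFun h0' ω; rw [Fop_apply] at this; simpa using this
  have hY : ∀ ω, ∑ i ∈ range m, up (dual P) i f ω = 0 := by
    intro ω; simp only [dual_up]; exact hY' ω
  have hnm : nx m (m - 1) = 0 := by unfold nx; rw [if_pos (by omega)]
  have hm1 : m - 1 < m := by omega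
  -- base case
  have base : ∀ ω, f ω ≠ 0 → P.a ω 0 = P.a ω (m - 1) := by
    intro ω hω
    have hq : q P ω = 0 := by by_contra h; exact hω (hf ω h)
    by_contra hne
    have c1 := P.a1 (m - 1) hm1 ω
    have c2 := P.a2 (m - 1) hm1 ω
    rw [hnm] at c1 c2
    rcases hb : P.a ω (m - 1) with _ | _
    · have hb0 : P.a ω 0 = true := by rw [hb] at hne; simpa using hne
      have hqB := q_up P hm1 ω hb (by rw [hnm, hb0])
      rw [hnm, hq] at hqB
      have hh := hY' (P.tau (m - 1) ω)
      rw [Finset.sum_eq_single (m - 1), dn_apply, hnm, c1, c2, hb, hb0] at hh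
      · simp [P.inv _ hm1] at hh; exact hω hh
      · intro i hi hne'
        rw [Finset.mem_range] at hi
        rw [dn_apply]
        split_ifs with h
        · apply hf
          rw [q_dn P hi _ h.1 h.2, hqB]
          unfold nx; rw [if_neg (by omega)]; push_cast; omega
        · rfl
      · intro h; simp at h; omega
    · have hb0 : P.a ω 0 = false := by rw [hb] at hne; simpa using hne
      have hqB := q_dn P hm1 ω hb (by rw [hnm, hb0])
      rw [hnm, hq] at hqB
      have hh := hX (P.tau (m - 1) ω)
      rw [Finset.sum_eq_single (m - 1), up_apply, hnm, c1, c2, hb, hb0] at hh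
      · simp [P.inv _ hm1] at hh; exact hω hh
      · intro i hi hne'
        rw [Finset.mem_range] at hi
        rw [up_apply]
        split_ifs with h
        · apply hf
          rw [q_up P hi _ h.1 h.2, hqB]
          unfold nx; rw [if_neg (by omega)]; push_cast; omega
        · rfl
      · intro h; simp at h; omega
  -- combined step
  have comb : ∀ j l, j + l + 1 = m → j + 1 < l → (∀ ω, f ω ≠ 0 → P.a ω j = P.a ω l) →
      ∀ ω, f ω ≠ 0 → P.a ω (j + 1) = P.a ω (l - 1) ∧
        (P.a ω (j + 1) ≠ P.a ω j → l - 1 ≠ j + 1 ∧ f (P.tau (l - 1) (P.tau j ω)) ≠ 0) := by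
    intro j l hl hj hsym ω hω
    have s1 := step P f hX j l hl hj hsym ω hω
    have s2 := step (dual P) f hY j l hl hj (by intro ω h; simp [dual, hsym ω h]) ω hω
    simp only [dual] at s2
    rcases x1 : P.a ω j with _ | _ <;> rcases x2 : P.a ω (j + 1) with _ | _ <;>
      rcases x3 : P.a ω (l - 1) with _ | _ <;> simp_all
  have sym : ∀ j l, j + l + 1 = m → j ≤ l → ∀ ω, f ω ≠ 0 → P.a ω j = P.a ω l := by
    intro j
    induction j with
    | zero => intro l hl _; rw [show l = m - 1 by omega]; exact base
    | succ j ih =>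
      intro l hl hjl ω hω
      exact (comb j (l + 1) (by omega) (by omega) (ih (l + 1) (by omega) (by omega)) ω hω).1
  have sym' : ∀ j l, j + l + 1 = m → ∀ ω, f ω ≠ 0 → P.a ω j = P.a ω l := by
    intro j l hl ω hω
    rcases le_total j l with h | h
    · exact sym j l hl h ω hω
    · exact (sym l j (by omega) h ω hω).symm
  ext ω0
  by_contra hω0
  rcases hgood ω0 with ⟨⟨c, hc⟩, i, hi, j, hj, hij⟩ | ⟨⟨c, hc⟩, hodd⟩
  · have claim : ∀ d, d ≤ c → ∀ ω, f ω ≠ 0 → P.a ω (c - d) = P.a ω c := by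
      intro d
      induction d with
      | zero => intro _ ω _; rfl
      | succ d ih =>
        intro hd ω hω
        by_contra hne
        have e := ih (by omega) ω hω
        obtain ⟨j, hj⟩ : ∃ j, j = c - (d + 1) := ⟨_, rfl⟩
        have hj1 : c - d = j + 1 := by omega
        rw [← hj] at hne
        rw [hj1] at e
        have hjm : j < m := by omega
        have hh := (comb j (m - 1 - j) (by omega) (by omega) (sym' j (m - 1 - j) (by omega)) ω hω).2
          (by rw [e]; exact Ne.symm hne)
        have e' := ih (by omega) _ hh.2
        have hl1 : m - 1 - j - 1 < m := by omega
        have hnj : nx m j = j + 1 := by unfold nx; rw [if_neg (by omega)]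
        have hnl : nx m (m - 1 - j - 1) = m - 1 - j := by unfold nx; rw [if_neg (by omega)]; omega
        have a2 := P.a2 j hjm ω
        rw [hnj] at a2
        rw [hj1, P.a3 _ hl1 (j + 1) (by omega) (by omega) (by omega),
          P.a3 _ hl1 c (by omega) (by omega) (by omega), a2,
          P.a3 _ hjm c (by omega) (by omega) (by omega)] at e'
        exact hne e'
    have all : ∀ i, i < m → P.a ω0 i = P.a ω0 c := by
      intro i hi
      rcases le_total i c with h | h
      · have := claim (c - i) (by omega) ω0 hω0
        rwa [show c - (c - i) = i by omega] at this
      · rw [sym' i (m - 1 - i) (by omega) ω0 hω0]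
        have := claim (c - (m - 1 - i)) (by omega) ω0 hω0
        rwa [show c - (c - (m - 1 - i)) = m - 1 - i by omega] at this
    exact hij ((all i hi).trans (all j hj).symm)
  · rw [← Nat.not_even_iff_odd] at hodd
    apply hodd
    rw [Finset.card_filter, show range m = range (c + c) from congrArg range hc, Finset.sum_range_add]
    refine ⟨∑ i ∈ range c, if P.a ω0 i = true then 1 else 0, ?_⟩
    congr 1
    rw [← Finset.sum_range_reflect]
    refine Finset.sum_congr rfl fun i hi => ?_
    rw [Finset.mem_range] at hi
    rw [sym' (c + (c - 1 - i)) i (by omega) ω0 hω0]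
  
theorem main_hop (s : Ω → ℝ)
    (hs : ∀ i, i + 1 < m → ∀ ω, P.a ω i = true → P.a ω (i + 1) = false → s ω < s (P.tau i ω))
    (hgood : ∀ ω, (Odd m ∧ ∃ i < m, ∃ j < m, P.a ω i ≠ P.a ω j) ∨
      (Even m ∧ Odd ((range m).filter (fun i => P.a ω i = true)).card)) (x : ℝ) :
    m * (univ.filter (fun ω => s ω = x)).card ≤ Fintype.card Ω :=
  (Nat.mul_le_mul_left m (sperner P s hs x)).trans (ring_card P (kernel P hgood))

end HopProof

namespace HopProof

noncomputable def pp {n : ℕ} (hn : 0 < n) (v : Fin n → ℝ) (i : ℕ) : Fin n :=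
  if h : i < n then Tuple.sort v ⟨i, h⟩ else Tuple.sort v ⟨0, hn⟩

lemma pp_inj {n : ℕ} (hn : 0 < n) (v : Fin n → ℝ) {i j : ℕ} (hi : i < n) (hj : j < n)
    (h : pp hn v i = pp hn v j) : i = j := by
  unfold pp at h
  rw [dif_pos hi, dif_pos hj] at h
  simpa using h

lemma pp_lt {n : ℕ} (hn : 0 < n) (v : Fin n → ℝ) (hv : Function.Injective v) {i : ℕ}
    (hi : i + 1 < n) : v (pp hn v i) < v (pp hn v (i + 1)) := by
  apply lt_of_le_of_ne
  · have := Tuple.monotone_sort v (a := ⟨i, by omega⟩) (b := ⟨i + 1, hi⟩) (by simp)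
    unfold pp
    rw [dif_pos hi, dif_pos (by omega : i < n)]
    exact this
  · intro h
    have := pp_inj hn v (by omega) hi (hv h)
    omega

lemma pp_surj {n : ℕ} (hn : 0 < n) (v : Fin n → ℝ) (k : Fin n) : ∃ i < n, pp hn v i = k := by
  refine ⟨((Tuple.sort v).symm k).1, ((Tuple.sort v).symm k).2, ?_⟩
  unfold pp
  rw [dif_pos ((Tuple.sort v).symm k).2]
  simp

noncomputable def permHop {n : ℕ} (hn : 0 < n) (w v : Fin n → ℝ) (θ : ℝ) (m : ℕ) (hm : m ≤ n)
    (h3 : 3 ≤ m) : Hop (Equiv.Perm (Fin n)) m where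
  a π i := decide (θ < w (π (pp hn v i)))
  tau i π := π * Equiv.swap (pp hn v i) (pp hn v (nx m i))
  m3 := h3
  inv i hi π := by rw [mul_assoc, Equiv.swap_mul_self, mul_one]
  a1 i hi π := by simp
  a2 i hi π := by simp
  a3 i hi k hk h1 h2 π := by
    have e1 : pp hn v k ≠ pp hn v i := fun h => h1 (pp_inj hn v (by omega) (by omega) h)
    have e2 : pp hn v k ≠ pp hn v (nx m i) := fun h =>
      h2 (pp_inj hn v (by omega) (by have := nx_lt hi; omega) h)
    simp [Equiv.swap_apply_of_ne_of_ne e1 e2]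
  comm i hi j hj h1 h2 h3 π := by
    have hi' := nx_lt hi
    have hj' := nx_lt hj
    have key : ∀ a b, a < m → b < m → a ≠ b → pp hn v a ≠ pp hn v b := fun a b ha hb hab h =>
      hab (pp_inj hn v (by omega) (by omega) h)
    have hnn : nx m i ≠ nx m j := by unfold nx; split_ifs <;> omega
    have hd : Equiv.Perm.Disjoint (Equiv.swap (pp hn v i) (pp hn v (nx m i)))
        (Equiv.swap (pp hn v j) (pp hn v (nx m j))) := by
      intro x
      by_cases hx1 : x = pp hn v i
      · right; subst hx1
        exact Equiv.swap_apply_of_ne_of_ne (key _ _ hi hj h1) (key _ _ hi hj' (Ne.symm h3))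
      · by_cases hx2 : x = pp hn v (nx m i)
        · right; subst hx2
          exact Equiv.swap_apply_of_ne_of_ne (key _ _ hi' hj h2) (key _ _ hi' hj' hnn)
        · left; exact Equiv.swap_apply_of_ne_of_ne hx1 hx2
    rw [mul_assoc, mul_assoc, hd.commute.eq]

lemma sum_swap {n : ℕ} (w v : Fin n → ℝ) (π : Equiv.Perm (Fin n)) (p r : Fin n) (hpr : p ≠ r)
    (h1 : w (π r) < w (π p)) (h2 : v p < v r) :
    ∑ i, w (π i) * v i < ∑ i, w ((π * Equiv.swap p r) i) * v i := by
  have : ∑ i, w ((π * Equiv.swap p r) i) * v i - ∑ i, w (π i) * v i =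
      (w (π p) - w (π r)) * (v r - v p) := by
    rw [← Finset.sum_sub_distrib, ← Finset.sum_subset (Finset.subset_univ {p, r}),
      Finset.sum_pair hpr]
    · simp; ring
    · intro x _ hx
      simp at hx
      simp [Equiv.swap_apply_of_ne_of_ne hx.1 hx.2]
  have h3 : 0 < (w (π p) - w (π r)) * (v r - v p) := mul_pos (by linarith) (by linarith)
  linarith

lemma perm_bound {n : ℕ} (hn : 0 < n) (w v : Fin n → ℝ) (hv : Function.Injective v) (θ : ℝ)
    (m : ℕ) (hm : m ≤ n) (h3 : 3 ≤ m)
    (hgood : ∀ π : Equiv.Perm (Fin n),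
      (Odd m ∧ ∃ i < m, ∃ j < m, ¬ (θ < w (π (pp hn v i)) ↔ θ < w (π (pp hn v j)))) ∨
      (Even m ∧ Odd ((range m).filter (fun i => θ < w (π (pp hn v i)))).card)) (x : ℝ) :
    m * (univ.filter (fun π : Equiv.Perm (Fin n) => ∑ i, w (π i) * v i = x)).card
      ≤ Nat.factorial n := by
  have := main_hop (permHop hn w v θ m hm h3) (fun π => ∑ i, w (π i) * v i) ?_ ?_ x
  · rw [Fintype.card_perm, Fintype.card_fin] at this
    convert this
  · intro i hi π h1 h2
    have hnx : nx m i = i + 1 := by unfold nx; rw [if_neg (by omega)]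
    simp only [permHop, decide_eq_true_eq, decide_eq_false_iff_not, not_lt] at h1 h2
    simp only [permHop, hnx]
    apply sum_swap
    · intro h; have := pp_inj hn v (by omega) (by omega) h; omega
    · linarith
    · exact pp_lt hn v hv (by omega)
  · intro π
    rcases hgood π with ⟨ho, i, hi, j, hj, h⟩ | ⟨he, ho⟩
    · left
      refine ⟨ho, i, hi, j, hj, ?_⟩
      simp only [permHop, ne_eq, decide_eq_decide]
      exact h
    · right
      refine ⟨he, ?_⟩
      simp only [permHop, decide_eq_true_eq]
      convert ho

lemma card_high {n : ℕ} (hn : 0 < n) (w v : Fin n → ℝ) (θ : ℝ) (π : Equiv.Perm (Fin n)) :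
    ((range n).filter (fun i => θ < w (π (pp hn v i)))).card =
      (univ.filter (fun i => θ < w i)).card := by
  apply Finset.card_bij (fun i _ => π (pp hn v i))
  · intro i hi; simp at hi ⊢; exact hi.2
  · intro i hi j hj h
    simp at hi hj
    exact pp_inj hn v hi.1 hj.1 (π.injective h)
  · intro k hk
    simp at hk
    obtain ⟨i, hi, h⟩ := pp_surj hn v (π.symm k)
    exact ⟨i, by simp [hi, h, hk], by simp [h]⟩

lemma final_nat (n : ℕ) (w v : Fin n → ℝ) (hv : Function.Injective v)
    (hw : ∃ i j : Fin n, w i ≠ w j) (x : ℝ) :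
    (Odd n → n * (univ.filter (fun π : Equiv.Perm (Fin n) => ∑ i, w (π i) * v i = x)).card
      ≤ Nat.factorial n) ∧
    (Even n → (n - 1) * (univ.filter (fun π : Equiv.Perm (Fin n) => ∑ i, w (π i) * v i = x)).card
      ≤ Nat.factorial n) := by
  obtain ⟨i0, j0, hlt⟩ : ∃ i j : Fin n, w i < w j := by
    obtain ⟨i, j, h⟩ := hw
    rcases lt_or_gt_of_ne h with h | h
    · exact ⟨i, j, h⟩
    · exact ⟨j, i, h⟩
  have hn : 0 < n := i0.pos
  have hn2 : 2 ≤ n := by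
    by_contra h
    have : i0 = j0 := by ext; omega
    rw [this] at hlt; exact lt_irrefl _ hlt
  have hnc : ∀ π : Equiv.Perm (Fin n), ∃ i < n, ∃ j < n,
      ¬ (w i0 < w (π (pp hn v i)) ↔ w i0 < w (π (pp hn v j))) := by
    intro π
    obtain ⟨i, hi, h1⟩ := pp_surj hn v (π.symm i0)
    obtain ⟨j, hj, h2⟩ := pp_surj hn v (π.symm j0)
    refine ⟨i, hi, j, hj, ?_⟩
    rw [h1, h2]; simp [hlt]
  constructor
  · intro ho
    have h3 : 3 ≤ n := by obtain ⟨c, hc⟩ := ho; omega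
    exact perm_bound hn w v hv (w i0) n le_rfl h3 (fun π => Or.inl ⟨ho, hnc π⟩) x
  · intro he
    by_cases h2 : n = 2
    · subst h2
      have := Finset.card_le_univ
        (univ.filter (fun π : Equiv.Perm (Fin 2) => ∑ i, w (π i) * v i = x))
      rw [Fintype.card_perm, Fintype.card_fin] at this
      simpa using this
    have h4 : 4 ≤ n := by obtain ⟨c, hc⟩ := he; omega
    rcases Nat.even_or_odd (univ.filter (fun i => w i0 < w i)).card with hk | hk
    · refine perm_bound hn w v hv (w i0) (n - 1) (by omega) (by omega) (fun π => Or.inl ⟨?_, ?_⟩) x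
      · obtain ⟨c, hc⟩ := he; exact ⟨c - 1, by omega⟩
      · by_contra hcon
        push Not at hcon
        have hcard := card_high hn w v (w i0) π
        obtain ⟨i, hi, j, hj, hij⟩ := hnc π
        obtain ⟨N, rfl⟩ : ∃ N, n = N + 1 := ⟨n - 1, by omega⟩
        simp only [Nat.add_sub_cancel] at hcon
        have hN : 0 < N := by omega
        rw [Finset.card_filter, Finset.sum_range_succ] at hcard
        have hNo : ¬ Even N := by
          intro h; have := he; rw [Nat.even_add_one] at this; exact this h
        by_cases h0 : w i0 < w (π (pp hn v 0))
        · have hall : ∀ i < N, w i0 < w (π (pp hn v i)) := fun i hi => (hcon 0 hN i hi).1 h0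
          rw [Finset.sum_congr rfl (fun i hi => if_pos (hall i (Finset.mem_range.1 hi)))] at hcard
          by_cases hl : w i0 < w (π (pp hn v N))
          · apply hij
            have : ∀ i < N + 1, w i0 < w (π (pp hn v i)) := by
              intro i hi
              rcases Nat.lt_succ_iff_lt_or_eq.1 hi with h | h
              · exact hall i h
              · rw [h]; exact hl
            simp [this i hi, this j hj]
          · rw [if_neg hl] at hcard
            simp only [sum_const, card_range, smul_eq_mul, mul_one, add_zero] at hcard
            rw [← hcard] at hk
            exact hNo hk
        · have hall : ∀ i < N, ¬ w i0 < w (π (pp hn v i)) := fun i hi h => h0 ((hcon 0 hN i hi).2 h)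
          rw [Finset.sum_congr rfl (fun i hi => if_neg (hall i (Finset.mem_range.1 hi)))] at hcard
          by_cases hl : w i0 < w (π (pp hn v N))
          · rw [if_pos hl] at hcard
            simp only [sum_const_zero, zero_add] at hcard
            rw [← hcard] at hk
            exact absurd hk (by decide)
          · apply hij
            have : ∀ i < N + 1, ¬ w i0 < w (π (pp hn v i)) := by
              intro i hi
              rcases Nat.lt_succ_iff_lt_or_eq.1 hi with h | h
              · exact hall i h
              · rw [h]; exact hl
            simp [this i hi, this j hj]
    · have := perm_bound hn w v hv (w i0) n le_rfl (by omega)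
        (fun π => Or.inr ⟨he, by rw [card_high]; exact hk⟩) x
      exact le_trans (Nat.mul_le_mul_right _ (by omega)) this

end HopProof

/-- Pawlowski's theorem: `v` with pairwise distinct coordinates, `w` not constant; then
`P(w_π ⬝ v = x) ≤ 1/n` for odd `n` and `≤ 1/(n-1)` for even `n`. -/
theorem stmt_7 (n : ℕ) (w v : Fin n → ℝ) (hv : Function.Injective v)
    (hw : ∃ i j : Fin n, w i ≠ w j) (x : ℝ) :
    (Odd n →
      ((Finset.univ.filter (fun π : Equiv.Perm (Fin n) =>
          ∑ i, w (π i) * v i = x)).card : ℝ) / (Nat.factorial n : ℝ) ≤ 1 / n) ∧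
    (Even n →
      ((Finset.univ.filter (fun π : Equiv.Perm (Fin n) =>
          ∑ i, w (π i) * v i = x)).card : ℝ) / (Nat.factorial n : ℝ) ≤ 1 / ((n : ℝ) - 1)) := by
  have hmain := HopProof.final_nat n w v hv hw x
  have hn2 : 2 ≤ n := by
    obtain ⟨i, j, h⟩ := hw
    by_contra h2
    apply h
    have : i = j := by ext; omega
    rw [this]
  have hf : (0 : ℝ) < Nat.factorial n := by exact_mod_cast Nat.factorial_pos n
  have hn2' : (2 : ℝ) ≤ n := by exact_mod_cast hn2
  constructor
  · intro ho
    have h := hmain.1 ho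
    rw [div_le_div_iff₀ hf (by linarith), one_mul, mul_comm]
    exact_mod_cast h
  · intro he
    have h := hmain.2 he
    rw [div_le_div_iff₀ hf (by linarith), one_mul, mul_comm]
    have h' : ((n - 1 : ℕ) : ℝ) * ((Finset.univ.filter (fun π : Equiv.Perm (Fin n) =>
          ∑ i, w (π i) * v i = x)).card : ℝ) ≤ (Nat.factorial n : ℝ) := by exact_mod_cast h
    rwa [Nat.cast_sub (by omega), Nat.cast_one] at h'
end
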